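/- Let N : (0,∞) → ℕ be the counting function of the eigenvalues of the problem (α,β) with α = 0 and β = 2a/b, i.e. N(λ) is the number of eigenvalues of this problem not exceeding λ, and set ν := ln κ − 3·ln a. Define, for each k ∈ ℕ, the function σ_k : [0,ν] → ℝ by σ_k(t) := κ^{−k}·N(e^{kν+t}). Then for every k ∈ ℕ and every t ∈ [0,ν] one has |σ_{k+1}(t) − σ_k(t)| ≤ κ^{−k}; in particular, the sequence (σ_k) converges uniformly on [0,ν]. -/

import Mathlib

open Set Filter

/-- First derivative on `[0,1]` (one-sided at the endpoints). -/
noncomputable def Y1 (y : ℝ → ℝ) : ℝ → ℝ := derivWithin y (Set.Icc 0 1)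
/-- Second derivative on `[0,1]`. -/
noncomputable def Y2 (y : ℝ → ℝ) : ℝ → ℝ := iteratedDerivWithin 2 y (Set.Icc 0 1)
/-- Third derivative on `[0,1]`. -/
noncomputable def Y3 (y : ℝ → ℝ) : ℝ → ℝ := iteratedDerivWithin 3 y (Set.Icc 0 1)

/-- `y` is a solution on `[0,1]` of `[y''' - λ P y]' + λ P y' = 0`:
`y ∈ C³[0,1]` and `y''' - λ P y` is (continuously) differentiable on `[0,1]`
with derivative `-λ P y'`. -/
def SolutionOn (P : ℝ → ℝ) (lam : ℝ) (y : ℝ → ℝ) : Prop :=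
  ContDiffOn ℝ 3 y (Set.Icc 0 1) ∧
  ∀ x ∈ Set.Icc (0:ℝ) 1,
    HasDerivWithinAt (fun t => Y3 y t - lam * P t * y t)
      (-(lam * P x * Y1 y x)) (Set.Icc 0 1) x

/-- `y` is not identically zero on `[0,1]`. -/
def Nontrivial01 (y : ℝ → ℝ) : Prop := ∃ x ∈ Set.Icc (0:ℝ) 1, y x ≠ 0

/-- The boundary conditions of the problem `(α, β)`. -/
def BC (α β : ℝ) (y : ℝ → ℝ) : Prop :=
  Y2 y 0 + α * y 0 - β * Y1 y 0 = 0 ∧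
  -β * Y3 y 0 + α * Y2 y 0 = 0 ∧
  Y2 y 1 + α * y 1 + β * Y1 y 1 = 0 ∧
  -β * Y3 y 1 - α * Y2 y 1 = 0

/-- `y` is an eigenfunction of the problem `(α, β)` with eigenvalue `lam`. -/
def Eigenfunction (P : ℝ → ℝ) (α β lam : ℝ) (y : ℝ → ℝ) : Prop :=
  Nontrivial01 y ∧ SolutionOn P lam y ∧ BC α β y

/-- `lam` is an eigenvalue of the problem `(α, β)`. -/
def IsEigenvalue (P : ℝ → ℝ) (α β lam : ℝ) : Prop :=
  ∃ y : ℝ → ℝ, Eigenfunction P α β lam y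

/-- The number `b = (1 - κ a)/(κ - 1)`. -/
noncomputable def bb (κ : ℕ) (a : ℝ) : ℝ := (1 - κ * a) / (κ - 1)

/-- `P` is a nondecreasing continuous function on `[0,1]` with `P 0 = 0`, `P 1 = 1`,
self-similar of Cantor type with parameters `κ ≥ 2` and `0 < a < 1/κ`. -/
def CantorSelfSimilar (P : ℝ → ℝ) (κ : ℕ) (a : ℝ) : Prop :=
  ContinuousOn P (Set.Icc 0 1) ∧ MonotoneOn P (Set.Icc 0 1) ∧
  P 0 = 0 ∧ P 1 = 1 ∧ 2 ≤ κ ∧ 0 < a ∧ a < 1 / κ ∧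
  (∀ k : ℕ, k < κ → ∃ c : ℝ, ∀ x ∈ Set.Icc (0:ℝ) 1,
      (κ : ℝ) * P (k * (a + bb κ a) + a * x) = P x + c) ∧
  (∀ k : ℕ, 1 ≤ k → k < κ →
      ∀ x ∈ Set.Ioo ((k:ℝ) * (a + bb κ a) - bb κ a) ((k:ℝ) * (a + bb κ a)),
      ∀ x' ∈ Set.Ioo ((k:ℝ) * (a + bb κ a) - bb κ a) ((k:ℝ) * (a + bb κ a)),
      P x = P x')

namespace CantorBeam

section Stieltjes

/-- A lower bound on the derivative gives a lower bound on increments. -/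
lemma mul_sub_le_of_le_hasDerivWithinAt {f f' : ℝ → ℝ} {m s t : ℝ}
    (hf : ∀ x ∈ Icc (0:ℝ) 1, HasDerivWithinAt f (f' x) (Icc 0 1) x)
    (hs : 0 ≤ s) (hst : s ≤ t) (ht : t ≤ 1) (hm : ∀ x ∈ Icc s t, m ≤ f' x) :
    m * (t - s) ≤ f t - f s := by
  have hsub : Icc s t ⊆ Icc (0:ℝ) 1 := Icc_subset_Icc hs ht
  have hd : ∀ x ∈ interior (Icc s t), HasDerivAt f (f' x) x := by
    intro x hx
    rw [interior_Icc] at hx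
    exact (hf x (hsub (Ioo_subset_Icc_self hx))).hasDerivAt
      (Icc_mem_nhds (by linarith [hx.1]) (by linarith [hx.2]))
  refine (convex_Icc s t).mul_sub_le_image_sub_of_le_deriv
    (fun x hx => ((hf x (hsub hx)).mono hsub).continuousWithinAt)
    (fun x hx => (hd x hx).differentiableAt.differentiableWithinAt)
    (fun x hx => ?_) s (left_mem_Icc.2 hst) t (right_mem_Icc.2 hst) hst
  rw [(hd x hx).deriv]
  exact hm x (interior_subset hx)

lemma le_of_hasDerivWithinAt_nonneg {f f' : ℝ → ℝ} {s t : ℝ}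
    (hf : ∀ x ∈ Icc (0:ℝ) 1, HasDerivWithinAt f (f' x) (Icc 0 1) x)
    (hs : 0 ≤ s) (hst : s ≤ t) (ht : t ≤ 1) (hm : ∀ x ∈ Icc s t, 0 ≤ f' x) : f s ≤ f t := by
  have := mul_sub_le_of_le_hasDerivWithinAt hf hs hst ht hm
  linarith

/-- A function that does not decrease over short steps does not decrease. -/
lemma le_of_forall_short_step {H : ℝ → ℝ} {s t δ : ℝ} (hδ : 0 < δ) (hst : s ≤ t)
    (h : ∀ x ∈ Icc s t, ∀ x' ∈ Icc s t, x ≤ x' → x' - x < δ → H x ≤ H x') : H s ≤ H t := by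
  obtain ⟨n, hn⟩ := exists_nat_gt ((t - s) / δ)
  have hn0 : (0:ℝ) < n := lt_of_le_of_lt (by have := sub_nonneg.2 hst; positivity) hn
  have hstep : (t - s) / n < δ := by
    rw [div_lt_iff₀ hδ] at hn
    rw [div_lt_iff₀ hn0]; linarith
  have hstep0 : 0 ≤ (t - s) / n := div_nonneg (sub_nonneg.2 hst) hn0.le
  have hmem : ∀ i : ℕ, i ≤ n → s + i * ((t - s) / n) ∈ Icc s t := by
    intro i hi
    have hi' : (i:ℝ) ≤ n := by exact_mod_cast hi
    have h1 : (i:ℝ) * ((t - s) / n) ≤ n * ((t - s) / n) := by gcongr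
    have h2 : (n:ℝ) * ((t - s) / n) = t - s := by field_simp
    exact ⟨by have : 0 ≤ (i:ℝ) * ((t - s) / n) := by positivity
              linarith, by linarith⟩
  have key : ∀ i : ℕ, i ≤ n → H s ≤ H (s + i * ((t - s) / n)) := by
    intro i
    induction i with
    | zero => intro _; simp
    | succ k ih =>
      intro hk
      refine (ih (by omega)).trans (h _ (hmem k (by omega)) _ (hmem (k + 1) hk) ?_ ?_)
      · push_cast; nlinarith
      · push_cast; linarith
  have := key n le_rfl
  have h2 : s + (n:ℝ) * ((t - s) / n) = t := by field_simp; ring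
  rwa [h2] at this

/-- `g` is a primitive of `f` with respect to `dP`, expressed through integration by parts. -/
def IsPrimitive (P f f' g : ℝ → ℝ) : Prop :=
  ∀ x ∈ Icc (0:ℝ) 1, HasDerivWithinAt (fun t => g t - P t * f t) (-(P x * f' x)) (Icc 0 1) x

lemma IsPrimitive.mul_sub_le {P f f' g : ℝ → ℝ} (hg : IsPrimitive P f f' g)
    (hP : MonotoneOn P (Icc 0 1))
    (hf : ∀ x ∈ Icc (0:ℝ) 1, HasDerivWithinAt f (f' x) (Icc 0 1) x)
    (hf' : ContinuousOn f' (Icc 0 1)) {m s t : ℝ}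
    (hs : 0 ≤ s) (hst : s ≤ t) (ht : t ≤ 1) (hm : ∀ x ∈ Icc s t, m ≤ f x) :
    m * (P t - P s) ≤ g t - g s := by
  obtain ⟨M, hM⟩ := isCompact_Icc.exists_bound_of_continuousOn hf'
  have hM0 : 0 ≤ M := (norm_nonneg _).trans (hM 0 ⟨le_rfl, zero_le_one⟩)
  have hsub : Icc s t ⊆ Icc (0:ℝ) 1 := Icc_subset_Icc hs ht
  have hPst : 0 ≤ P t - P s :=
    sub_nonneg.2 (hP (hsub (left_mem_Icc.2 hst)) (hsub (right_mem_Icc.2 hst)) hst)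
  have key : ∀ ε > 0, (m - ε) * (P t - P s) ≤ g t - g s := by
    intro ε hε
    have : g s - (m - ε) * P s ≤ g t - (m - ε) * P t := by
      refine le_of_forall_short_step (H := fun x => g x - (m - ε) * P x)
        (δ := ε / (M + 1)) (by positivity) hst ?_
      intro x hx x' hx' hxx' hlt
      have hΔ : 0 ≤ P x' - P x := sub_nonneg.2 (hP (hsub hx) (hsub hx') hxx')
      have hsub' : Icc x x' ⊆ Icc (0:ℝ) 1 := fun r hr =>
        hsub ⟨hx.1.trans hr.1, hr.2.trans hx'.2⟩
      have hb := (convex_Icc x x').norm_image_sub_le_of_norm_hasDerivWithin_le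
        (f := fun r => (g r - P r * f r) + P x * f r)
        (f' := fun r => -(P r * f' r) + P x * f' r) (C := (P x' - P x) * M)
        (fun r hr => (((hg r (hsub' hr)).add ((hf r (hsub' hr)).const_mul (P x))).mono hsub'))
        (by
          intro r hr
          have h1 : -(P r * f' r) + P x * f' r = -((P r - P x) * f' r) := by ring
          have h2 : 0 ≤ P r - P x := sub_nonneg.2 (hP (hsub hx) (hsub' hr) hr.1)
          have h3 : P r - P x ≤ P x' - P x :=
            sub_le_sub_right (hP (hsub' hr) (hsub hx') hr.2) _
          rw [h1, norm_neg, norm_mul, Real.norm_of_nonneg h2]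
          exact mul_le_mul h3 (hM r (hsub' hr)) (norm_nonneg _) hΔ)
        (left_mem_Icc.2 hxx') (right_mem_Icc.2 hxx')
      rw [Real.norm_eq_abs, Real.norm_of_nonneg (sub_nonneg.2 hxx')] at hb
      have hb' := (abs_le.1 hb).1
      have h4 : M * (x' - x) ≤ ε := by
        rw [lt_div_iff₀ (by positivity)] at hlt
        nlinarith [sub_nonneg.2 hxx']
      have h5 := mul_le_mul_of_nonneg_left h4 hΔ
      have h6 := mul_le_mul_of_nonneg_left (hm x' hx') hΔ
      nlinarith
    nlinarith
  refine le_of_forall_pos_le_add fun ε hε => ?_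
  have := key (ε / (P t - P s + 1)) (by positivity)
  have h2 : ε / (P t - P s + 1) * (P t - P s) ≤ ε := by
    rw [div_mul_eq_mul_div, div_le_iff₀ (by positivity)]
    nlinarith
  nlinarith

end Stieltjes

/-- Continuity induction: if `f ≥ 0` on `[c,t]` forces `f t ≥ f c`, then `f ≥ f c` everywhere. -/
lemma le_of_bootstrap {f : ℝ → ℝ} {c d : ℝ} (hf : ContinuousOn f (Icc c d)) (h0 : 0 < f c)
    (h : ∀ t ∈ Icc c d, (∀ s ∈ Icc c t, 0 ≤ f s) → f c ≤ f t) :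
    ∀ t ∈ Icc c d, f c ≤ f t := by
  have hhalf : ∀ t ∈ Icc c d, f c / 2 ≤ f t := by
    by_contra! hcon
    obtain ⟨t, ht, hlt⟩ := hcon
    have hK : IsCompact (Icc c d ∩ f ⁻¹' {f c / 2}) :=
      isCompact_Icc.of_isClosed_subset (hf.preimage_isClosed_of_isClosed isClosed_Icc
        isClosed_singleton) inter_subset_left
    have hivt : ∀ r ∈ Icc c d, f r ≤ f c / 2 → ∃ q ∈ Icc c r, f q = f c / 2 := by
      intro r hr hfr
      have := intermediate_value_Icc' hr.1 (hf.mono (Icc_subset_Icc_right hr.2))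
      exact this ⟨hfr, by linarith⟩
    obtain ⟨q, hq, hfq⟩ := hivt t ht hlt.le
    obtain ⟨t₀, ⟨ht₀, hft₀⟩, hleast⟩ :=
      hK.exists_isLeast ⟨q, ⟨hq.1, hq.2.trans ht.2⟩, hfq⟩
    have hft₀' : f t₀ = f c / 2 := hft₀
    have := h t₀ ht₀ (fun s hs => by
      by_contra! hneg
      obtain ⟨q', hq', hfq'⟩ := hivt s ⟨hs.1, hs.2.trans ht₀.2⟩ (by linarith)
      have h1 : t₀ ≤ q' := hleast ⟨⟨hq'.1, hq'.2.trans (hs.2.trans ht₀.2)⟩, hfq'⟩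
      have : s = t₀ := le_antisymm hs.2 (h1.trans hq'.2)
      rw [this] at hneg
      linarith)
    linarith
  intro t ht
  exact h t ht fun s hs => by linarith [hhalf s ⟨hs.1, hs.2.trans ht.2⟩]

section ODE

/-- Global existence on `[0,1]` for a globally Lipschitz field vanishing at the origin. -/
lemma exists_solution_of_lipschitz {ι : Type*} [Fintype ι] {v : ℝ → (ι → ℝ) → ι → ℝ}
    {K : NNReal} (hv : ∀ t ∈ Icc (0:ℝ) 1, LipschitzWith K (v t))
    (hc : ∀ x, ContinuousOn (fun t => v t x) (Icc 0 1))
    (h0 : ∀ t ∈ Icc (0:ℝ) 1, v t 0 = 0) (x₀ : ι → ℝ) :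
    ∃ α : ℝ → ι → ℝ, α 0 = x₀ ∧
      ∀ t ∈ Icc (0:ℝ) 1, HasDerivWithinAt α (v t (α t)) (Icc 0 1) t := by
  set M : ℝ := ‖x₀‖ * Real.exp K with hM
  have hM0 : 0 ≤ M := by positivity
  let c : (ι → ℝ) → ι → ℝ := fun x i => max (-M) (min M (x i))
  have hcl : LipschitzWith 1 c := by
    refine LipschitzWith.of_dist_le_mul fun x x' => ?_
    rw [NNReal.coe_one, one_mul]
    refine (dist_pi_le_iff dist_nonneg).2 fun i => ?_
    refine le_trans ?_ (dist_le_pi_dist x x' i)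
    have h1 : LipschitzWith 1 (fun r : ℝ => max (-M) (min M r)) :=
      (LipschitzWith.id.const_min M).const_max (-M)
    simpa using h1.dist_le_mul (x i) (x' i)
  have hcM : ∀ x, ‖c x‖ ≤ M := by
    intro x
    refine (pi_norm_le_iff_of_nonneg hM0).2 fun i => ?_
    rw [Real.norm_eq_abs, abs_le]
    exact ⟨le_max_left _ _, max_le (by linarith) (min_le_left _ _)⟩
  have hc0 : ∀ x, ‖x‖ ≤ M → c x = x := by
    intro x hx
    funext i
    have := abs_le.1 ((Real.norm_eq_abs _).symm.le.trans ((norm_le_pi_norm x i).trans hx))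
    simp only [c]
    rw [min_eq_right this.2, max_eq_right this.1]
  have hvn : ∀ t ∈ Icc (0:ℝ) 1, ∀ x, ‖v t x‖ ≤ K * ‖x‖ := by
    intro t ht x
    have := (hv t ht).dist_le_mul x 0
    rwa [h0 t ht, dist_zero_right, dist_zero_right] at this
  have hcx : ∀ x, ‖c x‖ ≤ ‖x‖ := by
    intro x
    have := hcl.dist_le_mul x 0
    rw [hc0 0 (by simpa using hM0)] at this
    simpa using this
  let Mn : NNReal := ⟨M, hM0⟩
  have hPL : IsPicardLindelof (fun t x => v t (c x)) (tmin := 0) (tmax := 1)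
      ⟨0, left_mem_Icc.2 zero_le_one⟩ x₀ (K * Mn) 0 (K * Mn) (K * 1) :=
    { lipschitzOnWith := fun t ht => ((hv t ht).comp hcl).lipschitzOnWith
      continuousOn := fun x _ => hc (c x)
      norm_le := fun t ht x _ => (hvn t ht _).trans (by
        push_cast
        exact mul_le_mul_of_nonneg_left (hcM x) K.2)
      mul_max_le := by simp }
  obtain ⟨α, hα0, hα⟩ := hPL.exists_eq_forall_mem_Icc_hasDerivWithinAt₀
  refine ⟨α, hα0, fun t ht => ?_⟩
  have hcont : ContinuousOn α (Icc 0 1) := fun t ht => (hα t ht).continuousWithinAt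
  have hb := norm_le_gronwallBound_of_norm_deriv_right_le (f := α) (δ := ‖x₀‖) (K := K) (ε := 0)
    hcont (fun t ht => ((hα t (Ico_subset_Icc_self ht)).mono_of_mem_nhdsWithin
      (Icc_mem_nhdsGE_of_mem ht))) (by rw [hα0]) (fun t ht => by
        rw [add_zero]
        exact (hvn t (Ico_subset_Icc_self ht) _).trans
          (mul_le_mul_of_nonneg_left (hcx _) K.2)) t ht
  rw [gronwallBound_ε0, sub_zero] at hb
  have hαM : ‖α t‖ ≤ M := hb.trans (by
    rw [hM]
    gcongr
    have := mul_le_mul_of_nonneg_left ht.2 K.2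
    simpa using this)
  have := hα t ht
  rwa [hc0 _ hαM] at this

end ODE

/-- The properties of the weight `P` used in the qualitative theory. -/
structure Weight (P : ℝ → ℝ) : Prop where
  cont : ContinuousOn P (Icc 0 1)
  mono : MonotoneOn P (Icc 0 1)
  zero : P 0 = 0
  one : P 1 = 1
  symm : ∀ x ∈ Icc (0:ℝ) 1, P (1 - x) = 1 - P x
  pos : ∀ x ∈ Ioc (0:ℝ) 1, 0 < P x

lemma one_sub_mem {x : ℝ} (hx : x ∈ Icc (0:ℝ) 1) : 1 - x ∈ Icc (0:ℝ) 1 :=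
  ⟨by linarith [hx.2], by linarith [hx.1]⟩

lemma zero_mem01 : (0:ℝ) ∈ Icc (0:ℝ) 1 := left_mem_Icc.2 zero_le_one

lemma one_mem01 : (1:ℝ) ∈ Icc (0:ℝ) 1 := right_mem_Icc.2 zero_le_one

namespace Weight

variable {P : ℝ → ℝ}

lemma nonneg (hP : Weight P) {x : ℝ} (hx : x ∈ Icc (0:ℝ) 1) : 0 ≤ P x := by
  have := hP.mono zero_mem01 hx hx.1
  rwa [hP.zero] at this

lemma le_one (hP : Weight P) {x : ℝ} (hx : x ∈ Icc (0:ℝ) 1) : P x ≤ 1 := by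
  have := hP.mono hx one_mem01 hx.2
  rwa [hP.one] at this

lemma lt_one (hP : Weight P) {x : ℝ} (h0 : 0 ≤ x) (h1 : x < 1) : P x < 1 := by
  have h2 := hP.symm x ⟨h0, h1.le⟩
  have h3 := hP.pos (1 - x) ⟨by linarith, by linarith⟩
  linarith

end Weight

/-- The equation as a first order system; `y2' = lam * z` and `dz = y dP`. -/
structure Sol (P : ℝ → ℝ) (lam : ℝ) (y y1 y2 z : ℝ → ℝ) : Prop where
  d0 : ∀ x ∈ Icc (0:ℝ) 1, HasDerivWithinAt y (y1 x) (Icc 0 1) x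
  d1 : ∀ x ∈ Icc (0:ℝ) 1, HasDerivWithinAt y1 (y2 x) (Icc 0 1) x
  d2 : ∀ x ∈ Icc (0:ℝ) 1, HasDerivWithinAt y2 (lam * z x) (Icc 0 1) x
  dz : IsPrimitive P y y1 z

/-- Right-hand side of the system in the variables `(y, y', y'', z - P y)`. -/
def field (P : ℝ → ℝ) (lam t : ℝ) (x : Fin 4 → ℝ) : Fin 4 → ℝ :=
  ![x 1, x 2, lam * (x 3 + P t * x 0), -(P t * x 1)]

namespace Sol

variable {P : ℝ → ℝ} {lam : ℝ} {y y1 y2 z u u1 u2 w : ℝ → ℝ}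

lemma c0 (h : Sol P lam y y1 y2 z) : ContinuousOn y (Icc 0 1) :=
  fun x hx => (h.d0 x hx).continuousWithinAt

lemma c1 (h : Sol P lam y y1 y2 z) : ContinuousOn y1 (Icc 0 1) :=
  fun x hx => (h.d1 x hx).continuousWithinAt

lemma c2 (h : Sol P lam y y1 y2 z) : ContinuousOn y2 (Icc 0 1) :=
  fun x hx => (h.d2 x hx).continuousWithinAt

lemma cz (hP : Weight P) (h : Sol P lam y y1 y2 z) : ContinuousOn z (Icc 0 1) := by
  have h1 : ContinuousOn (fun t => z t - P t * y t) (Icc 0 1) :=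
    fun x hx => (h.dz x hx).continuousWithinAt
  have h2 := h1.add (hP.cont.mul h.c0)
  refine h2.congr fun x _ => ?_
  simp

lemma lin (h : Sol P lam y y1 y2 z) (h' : Sol P lam u u1 u2 w) (a b : ℝ) :
    Sol P lam (fun x => a * y x + b * u x) (fun x => a * y1 x + b * u1 x)
      (fun x => a * y2 x + b * u2 x) (fun x => a * z x + b * w x) where
  d0 x hx := ((h.d0 x hx).const_mul a).add ((h'.d0 x hx).const_mul b)
  d1 x hx := ((h.d1 x hx).const_mul a).add ((h'.d1 x hx).const_mul b)
  d2 x hx := (((h.d2 x hx).const_mul a).add ((h'.d2 x hx).const_mul b)).congr_deriv (by ring)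
  dz x hx := ((((h.dz x hx).const_mul a).add ((h'.dz x hx).const_mul b)).congr_deriv
    (by ring)).congr_of_mem (fun t _ => by simp only [Pi.add_apply]; ring) hx

lemma smul (h : Sol P lam y y1 y2 z) (a : ℝ) :
    Sol P lam (fun x => a * y x) (fun x => a * y1 x) (fun x => a * y2 x) (fun x => a * z x) := by
  simpa using h.lin h a 0

lemma reflect (hP : Weight P) (h : Sol P lam y y1 y2 z) :
    Sol P lam (fun x => y (1 - x)) (fun x => -y1 (1 - x)) (fun x => y2 (1 - x))
      (fun x => -z (1 - x)) := by
  have key : ∀ (f : ℝ → ℝ) (d x : ℝ), x ∈ Icc (0:ℝ) 1 →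
      HasDerivWithinAt f d (Icc 0 1) (1 - x) →
      HasDerivWithinAt (fun x => f (1 - x)) (-d) (Icc 0 1) x := by
    intro f d x hx hf
    have h1 : HasDerivWithinAt (fun x : ℝ => 1 - x) (-1) (Icc 0 1) x := by
      simpa using (hasDerivWithinAt_id x (Icc (0:ℝ) 1)).const_sub 1
    have := hf.comp x h1 (fun t ht => one_sub_mem ht)
    simpa [Function.comp_def] using this
  refine ⟨fun x hx => key _ _ x hx (h.d0 _ (one_sub_mem hx)), fun x hx => ?_, fun x hx => ?_,
    fun x hx => ?_⟩
  · exact (key _ _ x hx (h.d1 _ (one_sub_mem hx))).neg.congr_deriv (neg_neg _)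
  · simpa using key _ _ x hx (h.d2 _ (one_sub_mem hx))
  · have h1 := (key _ _ x hx (h.dz _ (one_sub_mem hx))).neg
    have h2 := key _ _ x hx (h.d0 _ (one_sub_mem hx))
    refine ((h1.sub h2).congr_deriv ?_).congr_of_mem (fun t ht => ?_) hx
    · rw [hP.symm x hx]; ring
    · simp only [Pi.sub_apply, Pi.neg_apply]
      rw [hP.symm t ht]; ring

end Sol

section Field

variable {P : ℝ → ℝ} {lam : ℝ} {y y1 y2 z : ℝ → ℝ}

lemma field_lipschitz (hP : Weight P) (lam : ℝ) {t : ℝ} (ht : t ∈ Icc (0:ℝ) 1) :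
    LipschitzWith (1 + 2 * ‖lam‖₊) (field P lam t) := by
  refine LipschitzWith.of_dist_le_mul fun x x' => ?_
  have hc : ∀ i, |x i - x' i| ≤ dist x x' := fun i => by
    simpa [Real.dist_eq] using dist_le_pi_dist x x' i
  have hd : 0 ≤ dist x x' := dist_nonneg
  have hl : 0 ≤ |lam| := abs_nonneg lam
  have h0 := hP.nonneg ht
  have h1 := hP.le_one ht
  have hbig : dist x x' ≤ (1 + 2 * |lam|) * dist x x' := by nlinarith [mul_nonneg hl hd]
  push_cast
  rw [Real.norm_eq_abs]
  refine (dist_pi_le_iff (by positivity)).2 fun i => ?_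
  fin_cases i
  · simpa [field, Real.dist_eq] using (hc 1).trans hbig
  · simpa [field, Real.dist_eq] using (hc 2).trans hbig
  · have e : lam * (x 3 + P t * x 0) - lam * (x' 3 + P t * x' 0)
        = lam * ((x 3 - x' 3) + P t * (x 0 - x' 0)) := by ring
    have h2 : |(x 3 - x' 3) + P t * (x 0 - x' 0)| ≤ 2 * dist x x' := by
      refine (abs_add_le _ _).trans ?_
      rw [abs_mul, abs_of_nonneg h0]
      nlinarith [hc 3, hc 0, abs_nonneg (x 0 - x' 0)]
    have h3 := mul_le_mul_of_nonneg_left h2 hl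
    simp only [field, Real.dist_eq, Fin.reduceFinMk, Matrix.cons_val]
    rw [e, abs_mul]
    nlinarith
  · have e : -(P t * x 1) - -(P t * x' 1) = -(P t * (x 1 - x' 1)) := by ring
    simp only [field, Real.dist_eq, Fin.reduceFinMk, Matrix.cons_val]
    rw [e, abs_neg, abs_mul, abs_of_nonneg h0]
    nlinarith [hc 1, abs_nonneg (x 1 - x' 1)]

lemma field_continuousOn (hP : Weight P) (lam : ℝ) (x : Fin 4 → ℝ) :
    ContinuousOn (fun t => field P lam t x) (Icc 0 1) := by
  have := hP.cont
  refine continuousOn_pi.2 fun i => ?_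
  fin_cases i <;> simp only [field, Fin.zero_eta, Fin.mk_one, Fin.reduceFinMk, Matrix.cons_val] <;>
    fun_prop

/-- The state vector of a solution. -/
def state (P y y1 y2 z : ℝ → ℝ) (t : ℝ) : Fin 4 → ℝ := ![y t, y1 t, y2 t, z t - P t * y t]

lemma Sol.state_hasDeriv (h : Sol P lam y y1 y2 z) {t : ℝ} (ht : t ∈ Icc (0:ℝ) 1) :
    HasDerivWithinAt (state P y y1 y2 z) (field P lam t (state P y y1 y2 z t)) (Icc 0 1) t := by
  refine hasDerivWithinAt_pi.2 fun i => ?_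
  fin_cases i
  · simpa [state, field] using h.d0 t ht
  · simpa [state, field] using h.d1 t ht
  · simpa [state, field] using h.d2 t ht
  · simpa [state, field] using h.dz t ht

lemma exists_sol (hP : Weight P) (lam : ℝ) (x₀ : Fin 4 → ℝ) :
    ∃ y y1 y2 z : ℝ → ℝ, Sol P lam y y1 y2 z ∧ y 0 = x₀ 0 ∧ y1 0 = x₀ 1 ∧ y2 0 = x₀ 2 ∧
      z 0 = x₀ 3 := by
  obtain ⟨α, h0, hα⟩ := exists_solution_of_lipschitz (fun t ht => field_lipschitz hP lam ht)
    (field_continuousOn hP lam) (fun t _ => by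
      funext i; fin_cases i <;> simp [field]) x₀
  refine ⟨fun t => α t 0, fun t => α t 1, fun t => α t 2, fun t => α t 3 + P t * α t 0,
    ⟨fun t ht => ?_, fun t ht => ?_, fun t ht => ?_, fun t ht => ?_⟩, by simp [h0], by simp [h0],
    by simp [h0], by simp [h0, hP.zero]⟩
  · simpa [field] using hasDerivWithinAt_pi.1 (hα t ht) 0
  · simpa [field] using hasDerivWithinAt_pi.1 (hα t ht) 1
  · simpa [field] using hasDerivWithinAt_pi.1 (hα t ht) 2
  · simpa [field] using hasDerivWithinAt_pi.1 (hα t ht) 3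

lemma Sol.eq_zero_right (hP : Weight P) (h : Sol P lam y y1 y2 z) {c : ℝ} (hc : 0 ≤ c)
    (e0 : y c = 0) (e1 : y1 c = 0) (e2 : y2 c = 0) (e3 : z c = 0) :
    ∀ x ∈ Icc c 1, y x = 0 ∧ y1 x = 0 ∧ y2 x = 0 ∧ z x = 0 := by
  have hs : ∀ t ∈ Icc (0:ℝ) 1, HasDerivWithinAt (state P y y1 y2 z)
    (field P lam t (state P y y1 y2 z t)) (Icc 0 1) t := fun t ht => h.state_hasDeriv ht
  have key := ODE_solution_unique_of_mem_Icc_right (v := field P lam) (s := fun _ => univ)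
    (K := 1 + 2 * ‖lam‖₊) (a := c) (b := 1) (f := state P y y1 y2 z) (g := fun _ => 0)
    (fun t ht => (field_lipschitz hP lam ⟨hc.trans ht.1, ht.2.le⟩).lipschitzOnWith)
    (fun t ht => ((hs t ⟨hc.trans ht.1, ht.2⟩).continuousWithinAt).mono (Icc_subset_Icc_left hc))
    (fun t ht => (hs t ⟨hc.trans ht.1, ht.2.le⟩).mono_of_mem_nhdsWithin
      (Icc_mem_nhdsGE_of_mem ⟨hc.trans ht.1, ht.2⟩))
    (fun _ _ => mem_univ _) continuousOn_const
    (fun t _ => by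
      have : field P lam t 0 = 0 := by funext i; fin_cases i <;> simp [field]
      rw [this]; exact hasDerivWithinAt_const _ _ _)
    (fun _ _ => mem_univ _)
    (by funext i; fin_cases i <;> simp [state, e0, e1, e2, e3])
  intro x hx
  have hx' := key hx
  have i0 := congrFun hx' 0
  have i1 := congrFun hx' 1
  have i2 := congrFun hx' 2
  have i3 := congrFun hx' 3
  simp only [state, Matrix.cons_val, Pi.zero_apply] at i0 i1 i2 i3
  refine ⟨i0, i1, i2, ?_⟩
  simpa [i0] using i3

lemma Sol.eq_zero (hP : Weight P) (h : Sol P lam y y1 y2 z) {c : ℝ} (hc : c ∈ Icc (0:ℝ) 1)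
    (e0 : y c = 0) (e1 : y1 c = 0) (e2 : y2 c = 0) (e3 : z c = 0) :
    ∀ x ∈ Icc (0:ℝ) 1, y x = 0 ∧ y1 x = 0 ∧ y2 x = 0 ∧ z x = 0 := by
  intro x hx
  rcases le_total c x with hcx | hcx
  · exact h.eq_zero_right hP hc.1 e0 e1 e2 e3 x ⟨hcx, hx.2⟩
  · have := (h.reflect hP).eq_zero_right hP (c := 1 - c) (by linarith [hc.2]) (by simpa) (by simpa)
      (by simpa) (by simpa) (1 - x) ⟨by linarith, by linarith [hx.1]⟩
    simpa using this

/-- Two solutions with the same data at `0` agree. -/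
lemma Sol.eq_of_init (hP : Weight P) {u u1 u2 w : ℝ → ℝ} (h : Sol P lam y y1 y2 z)
    (h' : Sol P lam u u1 u2 w)
    (e0 : y 0 = u 0) (e1 : y1 0 = u1 0) (e2 : y2 0 = u2 0) (e3 : z 0 = w 0) :
    ∀ x ∈ Icc (0:ℝ) 1, y x = u x ∧ y1 x = u1 x ∧ y2 x = u2 x ∧ z x = w x := by
  intro x hx
  have := (h.lin h' 1 (-1)).eq_zero hP zero_mem01 (by simp [e0]) (by simp [e1])
    (by simp [e2]) (by simp [e3]) x hx
  obtain ⟨a, b, c, d⟩ := this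
  exact ⟨by linarith, by linarith, by linarith, by linarith⟩

end Field

section Growth

variable {P : ℝ → ℝ} {lam : ℝ} {y y1 y2 z : ℝ → ℝ}

lemma Sol.growth (hP : Weight P) (h : Sol P lam y y1 y2 z) (hl : 0 ≤ lam) {c t : ℝ}
    (hc : 0 ≤ c) (ht : t ≤ 1)
    (n1 : 0 ≤ y1 c) (n2 : 0 ≤ y2 c) (n3 : 0 ≤ z c) (hy : ∀ s ∈ Icc c t, 0 ≤ y s) :
    ∀ s ∈ Icc c t, y c ≤ y s ∧ y1 c ≤ y1 s ∧ y2 c ≤ y2 s ∧ z c ≤ z s := by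
  have g3 : ∀ s ∈ Icc c t, z c ≤ z s := fun s hs => by
    have := h.dz.mul_sub_le hP.mono h.d0 h.c1 hc hs.1 (hs.2.trans ht) (m := 0)
      (fun x hx => hy x ⟨hx.1, hx.2.trans hs.2⟩)
    linarith
  have g2 : ∀ s ∈ Icc c t, y2 c ≤ y2 s := fun s hs =>
    le_of_hasDerivWithinAt_nonneg h.d2 hc hs.1 (hs.2.trans ht)
      fun x hx => mul_nonneg hl (n3.trans (g3 x ⟨hx.1, hx.2.trans hs.2⟩))
  have g1 : ∀ s ∈ Icc c t, y1 c ≤ y1 s := fun s hs =>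
    le_of_hasDerivWithinAt_nonneg h.d1 hc hs.1 (hs.2.trans ht)
      fun x hx => n2.trans (g2 x ⟨hx.1, hx.2.trans hs.2⟩)
  exact fun s hs => ⟨le_of_hasDerivWithinAt_nonneg h.d0 hc hs.1 (hs.2.trans ht)
      fun x hx => n1.trans (g1 x ⟨hx.1, hx.2.trans hs.2⟩), g1 s hs, g2 s hs, g3 s hs⟩

/-- Nonnegative data propagate to the right. -/
lemma Sol.z_one_pos (hP : Weight P) (h : Sol P lam y y1 y2 z) (hl : 0 ≤ lam) {c : ℝ}
    (hc : 0 ≤ c) (hc1 : c < 1) (n0 : 0 ≤ y c)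
    (n1 : 0 ≤ y1 c) (n2 : 0 ≤ y2 c) (n3 : 0 ≤ z c) (hpos : 0 < y c ∨ 0 < z c ∨ 0 < y1 c) :
    0 < z 1 ∧ ∀ s ∈ Icc c 1, y c ≤ y s ∧ y1 c ≤ y1 s ∧ y2 c ≤ y2 s ∧ z c ≤ z s := by
  have base : ∀ c, 0 ≤ c → c < 1 → 0 < y c → 0 ≤ y1 c → 0 ≤ y2 c → 0 ≤ z c →
      0 < z 1 ∧ ∀ s ∈ Icc c 1, 0 ≤ y s := by
    intro c hc hc1 n0 n1 n2 n3
    have hsub : Icc c 1 ⊆ Icc (0:ℝ) 1 := Icc_subset_Icc_left hc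
    have hb := le_of_bootstrap (h.c0.mono hsub) n0 (fun t ht hs =>
      (h.growth hP hl hc ht.2 n1 n2 n3 hs t (right_mem_Icc.2 ht.1)).1)
    have hm := h.dz.mul_sub_le hP.mono h.d0 h.c1 hc hc1.le le_rfl hb
    rw [hP.one] at hm
    have := mul_pos n0 (sub_pos.2 (hP.lt_one hc hc1))
    exact ⟨by linarith, fun s hs => n0.le.trans (hb s hs)⟩
  have hsub : Icc c 1 ⊆ Icc (0:ℝ) 1 := Icc_subset_Icc_left hc
  suffices hmain : 0 < z 1 ∧ ∀ s ∈ Icc c 1, 0 ≤ y s from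
    ⟨hmain.1, h.growth hP hl hc le_rfl n1 n2 n3 hmain.2⟩
  have up : ∀ t ∈ Icc c 1, (∀ s ∈ Icc c t, 0 ≤ y1 s) → ∀ s ∈ Icc c t, 0 ≤ y s :=
    fun t ht hs s hs' => n0.trans (le_of_hasDerivWithinAt_nonneg h.d0 hc hs'.1
      (hs'.2.trans ht.2) fun x hx => hs x ⟨hx.1, hx.2.trans hs'.2⟩)
  rcases hpos with hpos | hpos | hpos
  · exact base c hc hc1 hpos n1 n2 n3
  · have up' : ∀ t ∈ Icc c 1, (∀ s ∈ Icc c t, 0 ≤ z s) → ∀ s ∈ Icc c t, 0 ≤ y s := by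
      intro t ht hs
      have a2 : ∀ s ∈ Icc c t, 0 ≤ y2 s := fun s hs' =>
        n2.trans (le_of_hasDerivWithinAt_nonneg h.d2 hc hs'.1
          (hs'.2.trans ht.2) fun x hx => mul_nonneg hl (hs x ⟨hx.1, hx.2.trans hs'.2⟩))
      exact up t ht fun s hs' =>
        n1.trans (le_of_hasDerivWithinAt_nonneg h.d1 hc hs'.1
          (hs'.2.trans ht.2) fun x hx => a2 x ⟨hx.1, hx.2.trans hs'.2⟩)
    have hb := le_of_bootstrap ((h.cz hP).mono hsub) hpos (fun t ht hs =>
      (h.growth hP hl hc ht.2 n1 n2 n3 (up' t ht hs) t (right_mem_Icc.2 ht.1)).2.2.2)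
    exact ⟨hpos.trans_le (hb 1 (right_mem_Icc.2 hc1.le)),
      up' 1 (right_mem_Icc.2 hc1.le) fun s hs => hpos.le.trans (hb s hs)⟩
  · have hb := le_of_bootstrap (h.c1.mono hsub) hpos (fun t ht hs =>
      (h.growth hP hl hc ht.2 n1 n2 n3 (up t ht hs) t (right_mem_Icc.2 ht.1)).2.1)
    have hy := up 1 (right_mem_Icc.2 hc1.le) fun s hs => hpos.le.trans (hb s hs)
    have hg := h.growth hP hl hc le_rfl n1 n2 n3 hy
    have hd : (c + 1) / 2 ∈ Icc c 1 := ⟨by linarith, by linarith⟩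
    have hyd := mul_sub_le_of_le_hasDerivWithinAt h.d0 hc hd.1 hd.2
      (fun x hx => hb x ⟨hx.1, hx.2.trans hd.2⟩)
    obtain ⟨-, g1, g2, g3⟩ := hg _ hd
    refine ⟨(base ((c + 1) / 2) (hc.trans hd.1) (by linarith) ?_ (n1.trans g1) (n2.trans g2)
      (n3.trans g3)).1, hy⟩
    have : 0 < y1 c * ((c + 1) / 2 - c) := mul_pos hpos (by linarith)
    linarith

lemma Sol.eq_zero_of_mul_nonneg (hP : Weight P) (h : Sol P lam y y1 y2 z) (hl : 0 ≤ lam) {c : ℝ}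
    (hc : 0 ≤ c) (hc1 : c < 1) (hz : z 1 = 0) (e1 : y1 c = 0) (e2 : y2 c = 0)
    (hyz : 0 ≤ y c * z c) : y c = 0 ∧ z c = 0 := by
  by_contra hne
  rcases mul_nonneg_iff.1 hyz with ⟨hy, hz'⟩ | ⟨hy, hz'⟩
  · refine (h.z_one_pos hP hl hc hc1 hy e1.ge e2.ge hz' ?_).1.ne' hz
    by_contra! hcon
    exact hne ⟨le_antisymm hcon.1 hy, le_antisymm hcon.2.1 hz'⟩
  · refine ((h.smul (-1)).z_one_pos hP hl hc hc1 (by linarith) (by simp [e1]) (by simp [e2])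
      (by linarith) ?_).1.ne' (by simp [hz])
    by_contra! hcon
    exact hne ⟨le_antisymm hy (by linarith [hcon.1]), le_antisymm hz' (by linarith [hcon.2.1])⟩

/-- `(y', y'')` never vanishes for a nontrivial solution with `z 0 = z 1 = 0`. -/
lemma Sol.ne_zero (hP : Weight P) (h : Sol P lam y y1 y2 z) (hl : 0 ≤ lam)
    (hz0 : z 0 = 0) (hz : z 1 = 0) (hnt : y 0 ≠ 0) {c : ℝ} (hc : c ∈ Icc (0:ℝ) 1) :
    y1 c ≠ 0 ∨ y2 c ≠ 0 := by
  by_contra! hcon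
  obtain ⟨e1, e2⟩ := hcon
  have hzero : y c = 0 ∧ z c = 0 := by
    rcases hc.2.lt_or_eq with hc1 | rfl
    · rcases le_total 0 (y c * z c) with hyz | hyz
      · exact h.eq_zero_of_mul_nonneg hP hl hc.1 hc1 hz e1 e2 hyz
      · rcases hc.1.lt_or_eq with hc0 | rfl
        · have := (h.reflect hP).eq_zero_of_mul_nonneg hP hl (c := 1 - c) (by linarith)
            (by linarith) (by simp [hz0]) (by simp [e1]) (by simp [e2]) (by simpa using hyz)
          simpa using this
        · exact h.eq_zero_of_mul_nonneg hP hl le_rfl hc1 hz e1 e2 (by simp [hz0])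
    · have := (h.reflect hP).eq_zero_of_mul_nonneg hP hl (c := 0) le_rfl one_pos
        (by simp [hz0]) (by simp [e1]) (by simp [e2]) (by simp [hz])
      simpa using this
  exact hnt (h.eq_zero hP hc hzero.1 e1 e2 hzero.2 0 zero_mem01).1

/-- Sign pattern at `0` of a nontrivial solution of the boundary problem. -/
lemma Sol.init_ne (hP : Weight P) (h : Sol P lam y y1 y2 z) (hl : 0 ≤ lam) {β : ℝ} (hβ : 0 < β)
    (hz0 : z 0 = 0) (hz : z 1 = 0) (hb : y2 0 = β * y1 0) (hnt : ∃ x ∈ Icc (0:ℝ) 1, y x ≠ 0) :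
    y 0 ≠ 0 ∧ y1 0 ≠ 0 := by
  obtain ⟨x, hx, hyx⟩ := hnt
  have key : ∀ {y y1 y2 z : ℝ → ℝ}, Sol P lam y y1 y2 z → z 0 = 0 → z 1 = 0 → y2 0 = β * y1 0 →
      0 ≤ y 0 → 0 ≤ y1 0 → y 0 = 0 ∧ y1 0 = 0 := by
    intro y y1 y2 z h hz0 hz hb n0 n1
    by_contra hne
    refine (h.z_one_pos hP hl le_rfl one_pos n0 n1 (by rw [hb]; positivity) hz0.ge ?_).1.ne' hz
    by_contra! hcon
    exact hne ⟨le_antisymm hcon.1 n0, le_antisymm hcon.2.2 n1⟩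
  have key2 : (0 ≤ y 0 ∧ 0 ≤ y1 0) ∨ (y 0 ≤ 0 ∧ y1 0 ≤ 0) → False := by
    intro hor
    have : y 0 = 0 ∧ y1 0 = 0 := by
      rcases hor with ⟨n0, n1⟩ | ⟨n0, n1⟩
      · exact key h hz0 hz hb n0 n1
      · have := key (h.smul (-1)) (by simp [hz0]) (by simp [hz]) (by rw [hb]; ring)
          (by linarith) (by linarith)
        exact ⟨by linarith [this.1], by linarith [this.2]⟩
    exact hyx (h.eq_zero hP zero_mem01 this.1 this.2 (by rw [hb, this.2, mul_zero]) hz0 x hx).1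
  constructor
  · intro e
    rcases le_total 0 (y1 0) with h1 | h1
    · exact key2 (Or.inl ⟨e.ge, h1⟩)
    · exact key2 (Or.inr ⟨e.le, h1⟩)
  · intro e
    rcases le_total 0 (y 0) with h1 | h1
    · exact key2 (Or.inl ⟨h1, e.ge⟩)
    · exact key2 (Or.inr ⟨h1, e.le⟩)

end Growth

section Family

variable {P : ℝ → ℝ}

lemma field_dist_le (hP : Weight P) (l l' : ℝ) {t : ℝ} (ht : t ∈ Icc (0:ℝ) 1) (x : Fin 4 → ℝ) :
    dist (field P l' t x) (field P l t x) ≤ |l' - l| * (2 * ‖x‖) := by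
  have h0 := hP.nonneg ht
  have h1 := hP.le_one ht
  have hc : ∀ i, |x i| ≤ ‖x‖ := fun i => by simpa using norm_le_pi_norm x i
  refine (dist_pi_le_iff (by positivity)).2 fun i => ?_
  have hp : 0 ≤ |l' - l| * (2 * ‖x‖) := by positivity
  fin_cases i
  · simpa [field] using hp
  · simpa [field] using hp
  · have e : l' * (x 3 + P t * x 0) - l * (x 3 + P t * x 0) = (l' - l) * (x 3 + P t * x 0) := by
      ring
    simp only [field, Real.dist_eq, Fin.reduceFinMk, Matrix.cons_val]
    rw [e, abs_mul]
    refine mul_le_mul_of_nonneg_left ((abs_add_le _ _).trans ?_) (abs_nonneg _)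
    rw [abs_mul, abs_of_nonneg h0]
    nlinarith [hc 3, hc 0, abs_nonneg (x 0)]
  · simpa [field] using hp

lemma flow_norm_le (hP : Weight P) {l L : ℝ} (hl : |l| ≤ L) {α : ℝ → Fin 4 → ℝ}
    (hα : ∀ t ∈ Icc (0:ℝ) 1, HasDerivWithinAt α (field P l t (α t)) (Icc 0 1) t)
    {t : ℝ} (ht : t ∈ Icc (0:ℝ) 1) : ‖α t‖ ≤ ‖α 0‖ * Real.exp (1 + 2 * L) := by
  have hL : 0 ≤ L := (abs_nonneg l).trans hl
  have hb := norm_le_gronwallBound_of_norm_deriv_right_le (f := α) (δ := ‖α 0‖) (K := 1 + 2 * L)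
    (ε := 0) (fun t ht => (hα t ht).continuousWithinAt)
    (fun t ht => ((hα t (Ico_subset_Icc_self ht)).mono_of_mem_nhdsWithin
      (Icc_mem_nhdsGE_of_mem ht))) le_rfl (fun t ht => by
        have h1 := (field_lipschitz hP l (Ico_subset_Icc_self ht)).dist_le_mul (α t) 0
        have h2 : field P l t 0 = 0 := by funext i; fin_cases i <;> simp [field]
        rw [h2, dist_zero_right, dist_zero_right] at h1
        refine h1.trans ?_
        push_cast
        rw [Real.norm_eq_abs, add_zero]
        gcongr) t ht
  rw [gronwallBound_ε0, sub_zero] at hb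
  refine hb.trans ?_
  gcongr
  nlinarith [ht.2]

lemma flow_dist_le (hP : Weight P) {l l' L : ℝ} (hl : |l| ≤ L) (hl' : |l'| ≤ L)
    {α α' : ℝ → Fin 4 → ℝ} (h0 : α' 0 = α 0)
    (hα : ∀ t ∈ Icc (0:ℝ) 1, HasDerivWithinAt α (field P l t (α t)) (Icc 0 1) t)
    (hα' : ∀ t ∈ Icc (0:ℝ) 1, HasDerivWithinAt α' (field P l' t (α' t)) (Icc 0 1) t)
    {t : ℝ} (ht : t ∈ Icc (0:ℝ) 1) :
    dist (α t) (α' t) ≤ 2 * ‖α 0‖ * Real.exp (1 + 2 * L) ^ 2 * |l - l'| := by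
  have hL : 0 ≤ L := (abs_nonneg l).trans hl
  have hder : ∀ {l : ℝ} {α : ℝ → Fin 4 → ℝ},
      (∀ t ∈ Icc (0:ℝ) 1, HasDerivWithinAt α (field P l t (α t)) (Icc 0 1) t) →
      ∀ t ∈ Ico (0:ℝ) 1, HasDerivWithinAt α (field P l t (α t)) (Ici t) t :=
    fun hα t ht => (hα t (Ico_subset_Icc_self ht)).mono_of_mem_nhdsWithin
      (Icc_mem_nhdsGE_of_mem ht)
  have key := dist_le_of_approx_trajectories_ODE_of_mem (v := field P l) (s := fun _ => univ)
    (K := (1 + 2 * L).toNNReal) (a := 0) (b := 1) (f := α) (g := α') (δ := 0) (εf := 0)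
    (εg := |l' - l| * (2 * (‖α 0‖ * Real.exp (1 + 2 * L))))
    (fun t ht => ((field_lipschitz hP l (Ico_subset_Icc_self ht)).weaken (by
      rw [← NNReal.coe_le_coe, Real.coe_toNNReal _ (by positivity)]
      push_cast
      rw [Real.norm_eq_abs]
      linarith)).lipschitzOnWith)
    (fun t ht => (hα t ht).continuousWithinAt) (hder hα) (fun t _ => (dist_self _).le)
    (fun _ _ => mem_univ _)
    (fun t ht => (hα' t ht).continuousWithinAt) (hder hα')
    (fun t ht => (field_dist_le hP l l' (Ico_subset_Icc_self ht) _).trans (by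
      have := flow_norm_le hP hl' hα' (Ico_subset_Icc_self ht)
      rw [h0] at this
      gcongr)) (fun _ _ => mem_univ _) (by rw [h0, dist_self]) t ht
  have hK : (1 + 2 * L) ≠ 0 := by positivity
  rw [Real.coe_toNNReal _ (by positivity), gronwallBound_of_K_ne_0 hK] at key
  refine key.trans ?_
  set E := Real.exp (1 + 2 * L) with hE
  have hE1 : 0 < E := Real.exp_pos _
  have h1 : Real.exp ((1 + 2 * L) * (t - 0)) ≤ E := by
    rw [hE]; gcongr; nlinarith [ht.2]
  have h2 : |l' - l| * (2 * (‖α 0‖ * E)) / (1 + 2 * L) ≤ |l' - l| * (2 * (‖α 0‖ * E)) :=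
    div_le_self (by positivity) (by linarith)
  have h3 : 0 ≤ Real.exp ((1 + 2 * L) * (t - 0)) - 1 := by
    rw [sub_nonneg]
    exact Real.one_le_exp (by have := ht.1; rw [sub_zero]; positivity)
  have h4 := mul_le_mul h2 (show Real.exp ((1 + 2 * L) * (t - 0)) - 1 ≤ E by linarith) h3
    (by positivity)
  rw [abs_sub_comm l l']
  simp only [zero_add, zero_mul]
  calc _ ≤ _ := h4
    _ = _ := by ring

/-- Solutions with fixed data at `0` depend continuously on `(lam, x)`. -/
lemma exists_continuous_family (hP : Weight P) (x₀ : Fin 4 → ℝ) :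
    ∃ y y1 y2 z : ℝ → ℝ → ℝ,
      (∀ l, Sol P l (y l) (y1 l) (y2 l) (z l) ∧ y l 0 = x₀ 0 ∧ y1 l 0 = x₀ 1 ∧ y2 l 0 = x₀ 2 ∧
        z l 0 = x₀ 3) ∧
      Continuous (fun p : ℝ × ℝ => y p.1 p.2) ∧ Continuous (fun p : ℝ × ℝ => y1 p.1 p.2) ∧
      Continuous (fun p : ℝ × ℝ => y2 p.1 p.2) ∧ Continuous (fun p : ℝ × ℝ => z p.1 p.2) := by
  have hex : ∀ l : ℝ, ∃ α : ℝ → Fin 4 → ℝ, α 0 = x₀ ∧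
      ∀ t ∈ Icc (0:ℝ) 1, HasDerivWithinAt α (field P l t (α t)) (Icc 0 1) t := fun l =>
    exists_solution_of_lipschitz (fun t ht => field_lipschitz hP l ht)
      (field_continuousOn hP l) (fun t _ => by
        funext i; fin_cases i <;> simp [field]) x₀
  choose α hα0 hα using hex
  let q : ℝ → ℝ := fun x => (projIcc (0:ℝ) 1 zero_le_one x : ℝ)
  have hq : Continuous q := continuous_subtype_val.comp continuous_projIcc
  have hqm : ∀ x, q x ∈ Icc (0:ℝ) 1 := fun x => (projIcc (0:ℝ) 1 zero_le_one x).2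
  have hqe : ∀ x ∈ Icc (0:ℝ) 1, q x = x := fun x hx => by
    simp only [q, projIcc_of_mem zero_le_one hx]
  have hcont : Continuous (fun p : ℝ × ℝ => α p.1 (q p.2)) := by
    rw [continuous_iff_continuousAt]
    intro p
    have hL : 0 ≤ |p.1| + 1 := by positivity
    set C : ℝ := 2 * ‖x₀‖ * Real.exp (1 + 2 * (|p.1| + 1)) ^ 2 with hC
    have hon : ContinuousOn (fun p : ℝ × ℝ => α p.1 (q p.2))
        (Icc (-(|p.1| + 1)) (|p.1| + 1) ×ˢ univ) := by
      refine continuousOn_prod_of_continuousOn_lipschitzOnWith (fun p : ℝ × ℝ => α p.1 (q p.2))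
        C.toNNReal (fun l _ => ?_) (fun x _ => ?_)
      · have h1 : ContinuousOn (α l) (Icc 0 1) := fun t ht => (hα l t ht).continuousWithinAt
        exact h1.comp hq.continuousOn (fun x _ => hqm x)
      · refine LipschitzOnWith.of_dist_le_mul fun l hl l' hl' => ?_
        have := flow_dist_le hP (abs_le.2 hl) (abs_le.2 hl') ((hα0 l').trans (hα0 l).symm)
          (hα l) (hα l') (hqm x)
        rw [hα0] at this
        rwa [Real.coe_toNNReal _ (by positivity)]
    refine hon.continuousAt (prod_mem_nhds (Icc_mem_nhds ?_ ?_) univ_mem)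
    · linarith [neg_abs_le p.1]
    · linarith [le_abs_self p.1]
  have hPq : Continuous fun x => P (q x) := by
    rw [← continuousOn_univ]
    exact hP.cont.comp hq.continuousOn (fun x _ => hqm x)
  have hci : ∀ i, Continuous (fun p : ℝ × ℝ => α p.1 (q p.2) i) := fun i =>
    (continuous_apply i).comp hcont
  have hqd : ∀ {f : ℝ → ℝ} {d x : ℝ}, x ∈ Icc (0:ℝ) 1 → HasDerivWithinAt f d (Icc 0 1) x →
      HasDerivWithinAt (fun x => f (q x)) d (Icc 0 1) x := fun hx hf =>
    hf.congr_of_mem (fun t ht => by rw [hqe t ht]) hx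
  refine ⟨fun l x => α l (q x) 0, fun l x => α l (q x) 1, fun l x => α l (q x) 2,
    fun l x => α l (q x) 3 + P (q x) * α l (q x) 0, fun l => ⟨⟨?_, ?_, ?_, ?_⟩, ?_⟩,
    hci 0, hci 1, hci 2, (hci 3).add ((hPq.comp continuous_snd).mul (hci 0))⟩
  · intro x hx
    have := hqd hx (hasDerivWithinAt_pi.1 (hα l x hx) 0)
    simpa [field, hqe x hx] using this
  · intro x hx
    have := hqd hx (hasDerivWithinAt_pi.1 (hα l x hx) 1)
    simpa [field, hqe x hx] using this
  · intro x hx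
    have := hqd hx (hasDerivWithinAt_pi.1 (hα l x hx) 2)
    simpa [field, hqe x hx] using this
  · intro x hx
    have := hqd hx (hasDerivWithinAt_pi.1 (hα l x hx) 3)
    refine HasDerivWithinAt.congr_of_mem (f := fun x => α l (q x) 3) ?_ (fun t ht => ?_) hx
    · simpa [field, hqe x hx] using this
    · simp [hqe t ht]
  · have h0 : q 0 = 0 := hqe 0 zero_mem01
    simp [h0, hα0, hP.zero]

/-- A continuous family of solutions satisfying all boundary conditions except the one on `y2`
at the right end. -/
structure Shooting (P : ℝ → ℝ) (β : ℝ) (y y1 y2 z : ℝ → ℝ → ℝ) : Prop where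
  sol : ∀ l, Sol P l (y l) (y1 l) (y2 l) (z l)
  cy : Continuous (fun p : ℝ × ℝ => y p.1 p.2)
  cy1 : Continuous (fun p : ℝ × ℝ => y1 p.1 p.2)
  cy2 : Continuous (fun p : ℝ × ℝ => y2 p.1 p.2)
  cz : Continuous (fun p : ℝ × ℝ => z p.1 p.2)
  z_zero : ∀ l, z l 0 = 0
  z_one : ∀ l, z l 1 = 0
  bc_zero : ∀ l, y2 l 0 = β * y1 l 0
  y_zero_neg : ∀ l, 0 ≤ l → y l 0 < 0
  y1_zero_pos : ∀ l, 0 ≤ l → 0 < y1 l 0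

lemma exists_shooting (hP : Weight P) {β : ℝ} (hβ : 0 < β) :
    ∃ y y1 y2 z : ℝ → ℝ → ℝ, Shooting P β y y1 y2 z := by
  obtain ⟨u, u1, u2, zu, hu, cu, cu1, cu2, czu⟩ := exists_continuous_family hP ![1, 0, 0, 0]
  obtain ⟨v, v1, v2, zv, hv, cv, cv1, cv2, czv⟩ := exists_continuous_family hP ![0, 1, β, 0]
  simp only [Matrix.cons_val] at hu hv
  have hzu : ∀ l, 0 ≤ l → 0 < zu l 1 := fun l hl => by
    obtain ⟨h, e0, e1, e2, e3⟩ := hu l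
    exact (h.z_one_pos hP hl le_rfl one_pos (by simp [e0]) e1.ge e2.ge e3.ge
      (Or.inl (by simp [e0]))).1
  have hzv : ∀ l, 0 ≤ l → 0 < zv l 1 := fun l hl => by
    obtain ⟨h, e0, e1, e2, e3⟩ := hv l
    exact (h.z_one_pos hP hl le_rfl one_pos e0.ge (by simp [e1]) (by simp [e2, hβ.le]) e3.ge
      (Or.inr (Or.inr (by simp [e1])))).1
  have a : Continuous (fun p : ℝ × ℝ => zu p.1 1) :=
    czu.comp (continuous_fst.prodMk continuous_const)
  have b : Continuous (fun p : ℝ × ℝ => -zv p.1 1) :=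
    (czv.comp (continuous_fst.prodMk continuous_const)).neg
  refine ⟨_, _, _, _, fun l => (hv l).1.lin (hu l).1 (zu l 1) (-zv l 1),
    (a.mul cv).add (b.mul cu), (a.mul cv1).add (b.mul cu1), (a.mul cv2).add (b.mul cu2),
    (a.mul czv).add (b.mul czu), fun l => ?_, fun l => ?_, fun l => ?_, fun l hl => ?_,
    fun l hl => ?_⟩
  · simp [hu l, hv l]
  · ring
  · simp [hu l, hv l, mul_comm]
  · simpa [hu l, hv l] using hzv l hl
  · simpa [hu l, hv l] using hzu l hl

end Family

section Polar

/-- Speed of rotation of the vector `(U, V)` when `U' = V` and `V' = W`. -/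
noncomputable def rot (U V W : ℝ → ℝ) (x : ℝ) : ℝ :=
  (U x * W x - V x ^ 2) / (U x ^ 2 + V x ^ 2)

lemma polar {U V W φ : ℝ → ℝ}
    (hU : ∀ x ∈ Icc (0:ℝ) 1, HasDerivWithinAt U (V x) (Icc 0 1) x)
    (hV : ∀ x ∈ Icc (0:ℝ) 1, HasDerivWithinAt V (W x) (Icc 0 1) x)
    (hne : ∀ x ∈ Icc (0:ℝ) 1, 0 < U x ^ 2 + V x ^ 2)
    (hφ : ∀ x ∈ Icc (0:ℝ) 1, HasDerivWithinAt φ (rot U V W x) (Icc 0 1) x)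
    (h0 : U 0 = √(U 0 ^ 2 + V 0 ^ 2) * Real.cos (φ 0))
    (h0' : V 0 = √(U 0 ^ 2 + V 0 ^ 2) * Real.sin (φ 0)) :
    ∀ x ∈ Icc (0:ℝ) 1, U x = √(U x ^ 2 + V x ^ 2) * Real.cos (φ x) ∧
      V x = √(U x ^ 2 + V x ^ 2) * Real.sin (φ x) := by
  set ρ : ℝ → ℝ := fun x => √(U x ^ 2 + V x ^ 2) with hρ
  have hρpos : ∀ x ∈ Icc (0:ℝ) 1, 0 < ρ x := fun x hx => Real.sqrt_pos.2 (hne x hx)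
  have hρsq : ∀ x ∈ Icc (0:ℝ) 1, ρ x ^ 2 = U x ^ 2 + V x ^ 2 := fun x hx =>
    Real.sq_sqrt (hne x hx).le
  have hρd : ∀ x ∈ Icc (0:ℝ) 1,
      HasDerivWithinAt ρ ((U x * V x + V x * W x) / ρ x) (Icc 0 1) x := fun x hx =>
    ((((hU x hx).pow 2).add ((hV x hx).pow 2)).sqrt (hne x hx).ne').congr_deriv (by
      simp only [hρ, Pi.add_apply, Pi.pow_apply]
      have := (hρpos x hx).ne'
      simp only [hρ] at this
      push_cast
      field_simp)
  let C : ℝ → ℝ := fun x => U x / ρ x * Real.cos (φ x) + V x / ρ x * Real.sin (φ x)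
  have hC : ∀ x ∈ Icc (0:ℝ) 1, HasDerivWithinAt C 0 (Icc 0 1) x := fun x hx => by
    have hr := (hρpos x hx).ne'
    have h1 := (((hU x hx).div (hρd x hx) hr).mul (hφ x hx).cos).add
      (((hV x hx).div (hρd x hx) hr).mul (hφ x hx).sin)
    refine h1.congr_deriv ?_
    have hs := hρsq x hx
    simp only [Pi.div_apply, rot]
    rw [← hs]
    field_simp
    linear_combination (Real.cos (φ x) * V x + Real.sin (φ x) * W x) * hs
  have hC1 : ∀ x ∈ Icc (0:ℝ) 1, C x = 1 := by
    intro x hx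
    have hconst := (convex_Icc (0:ℝ) 1).norm_image_sub_le_of_norm_hasDerivWithin_le (C := 0)
      hC (fun x _ => by simp) zero_mem01 hx
    rw [zero_mul, norm_le_zero_iff, sub_eq_zero] at hconst
    rw [hconst]
    have hr := (hρpos 0 zero_mem01).ne'
    have e1 : U 0 / ρ 0 = Real.cos (φ 0) := by rw [div_eq_iff hr, mul_comm]; exact h0
    have e2 : V 0 / ρ 0 = Real.sin (φ 0) := by rw [div_eq_iff hr, mul_comm]; exact h0'
    simp only [C, e1, e2]
    nlinarith [Real.sin_sq_add_cos_sq (φ 0)]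
  intro x hx
  have hr := (hρpos x hx).ne'
  have hone : (U x / ρ x) ^ 2 + (V x / ρ x) ^ 2 = 1 := by
    rw [div_pow, div_pow, ← add_div, ← hρsq x hx, div_self (pow_ne_zero 2 hr)]
  have hsum : (U x / ρ x - Real.cos (φ x)) ^ 2 + (V x / ρ x - Real.sin (φ x)) ^ 2 = 0 := by
    have := hC1 x hx
    simp only [C] at this
    nlinarith [Real.sin_sq_add_cos_sq (φ x)]
  have e1 : U x / ρ x - Real.cos (φ x) = 0 := by
    refine pow_eq_zero_iff (two_ne_zero) |>.1 (le_antisymm ?_ (sq_nonneg _))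
    nlinarith [sq_nonneg (V x / ρ x - Real.sin (φ x))]
  have e2 : V x / ρ x - Real.sin (φ x) = 0 := by
    refine pow_eq_zero_iff (two_ne_zero) |>.1 (le_antisymm ?_ (sq_nonneg _))
    nlinarith [sq_nonneg (U x / ρ x - Real.cos (φ x))]
  rw [sub_eq_zero, div_eq_iff hr, mul_comm] at e1 e2
  exact ⟨e1, e2⟩

/-- A level crossed only downwards is crossed at most once. -/
lemma lt_of_level_decreasing {f f' : ℝ → ℝ} {L s t : ℝ}
    (hf : ∀ x ∈ Icc (0:ℝ) 1, HasDerivWithinAt f (f' x) (Icc 0 1) x)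
    (hL : ∀ x ∈ Icc (0:ℝ) 1, f x = L → f' x < 0)
    (hs : 0 ≤ s) (hst : s < t) (ht : t ≤ 1) (h : f s ≤ L) : f t < L := by
  have hsub : Icc s t ⊆ Icc (0:ℝ) 1 := Icc_subset_Icc hs ht
  have hle := image_le_of_deriv_right_lt_deriv_boundary (f := f) (f' := f') (a := s) (b := t)
    (fun x hx => ((hf x (hsub hx)).continuousWithinAt).mono hsub)
    (fun x hx => (hf x (hsub (Ico_subset_Icc_self hx))).mono_of_mem_nhdsWithin
      (Icc_mem_nhdsGE_of_mem ⟨hs.trans hx.1, hx.2.trans_le ht⟩))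
    (B := fun _ => L) (B' := fun _ => 0) h (fun x => hasDerivAt_const x L)
    (fun x hx => hL x (hsub (Ico_subset_Icc_self hx)))
  have htm : t ∈ Icc s t := right_mem_Icc.2 hst.le
  refine lt_of_le_of_ne (hle htm) fun heq => ?_
  have hd := hL t (hsub htm) heq
  have hd2 := (hf t (hsub htm)).mono hsub
  rw [hasDerivWithinAt_iff_tendsto_slope, Icc_sdiff_right] at hd2
  have : (nhdsWithin t (Ico s t)).NeBot := right_nhdsWithin_Ico_neBot hst
  refine absurd (ge_of_tendsto hd2 (eventually_nhdsWithin_of_forall fun x hx => ?_)) hd.not_ge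
  rw [slope_def_field]
  have h1 := hle (Ico_subset_Icc_self hx)
  exact div_nonneg_of_nonpos (by rw [heq]; linarith) (by linarith [hx.2])

/-- The zeros of `cos ∘ φ` are counted by the final value of `φ`. -/
lemma ncard_zeros_cos {φ φ' : ℝ → ℝ} {k : ℕ}
    (hφ : ∀ x ∈ Icc (0:ℝ) 1, HasDerivWithinAt φ (φ' x) (Icc 0 1) x)
    (hlev : ∀ x ∈ Icc (0:ℝ) 1, Real.cos (φ x) = 0 → φ' x < 0)
    (h0 : φ 0 ∈ Ioo (-(Real.pi / 2)) (Real.pi / 2))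
    (h1 : -(Real.pi / 2) - Real.pi * k < φ 1) (h1' : φ 1 < Real.pi / 2 - Real.pi * k) :
    {x ∈ Ioo (0:ℝ) 1 | Real.cos (φ x) = 0}.Finite ∧
      {x ∈ Ioo (0:ℝ) 1 | Real.cos (φ x) = 0}.ncard = k := by
  have hpi := Real.pi_pos
  let L : ℤ → ℝ := fun j => -(Real.pi / 2) - Real.pi * j
  have hcos : ∀ j : ℤ, ∀ x, φ x = L j → Real.cos (φ x) = 0 := fun j x h => by
    rw [Real.cos_eq_zero_iff]
    exact ⟨-j - 1, by rw [h]; simp only [L]; push_cast; ring⟩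
  have hcross : ∀ (j : ℤ) {s t : ℝ}, 0 ≤ s → s < t → t ≤ 1 → φ s ≤ L j → φ t < L j :=
    fun j s t hs hst ht h => lt_of_level_decreasing hφ
      (fun x hx hx' => hlev x hx (hcos j x hx')) hs hst ht h
  have hex : ∀ j : ℕ, j < k → ∃ x ∈ Ioo (0:ℝ) 1, φ x = L j := fun j hj => by
    have hc : ContinuousOn φ (Icc 0 1) := fun x hx => (hφ x hx).continuousWithinAt
    have hj' : (j:ℝ) + 1 ≤ k := by exact_mod_cast hj
    have hmem : L j ∈ Ioo (φ 1) (φ 0) := by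
      constructor
      · simp only [L]; push_cast; nlinarith
      · simp only [L]; push_cast
        have : 0 ≤ Real.pi * j := by positivity
        linarith [h0.1]
    obtain ⟨x, hx, hxe⟩ := intermediate_value_Ioo' zero_le_one hc hmem
    exact ⟨x, hx, hxe⟩
  choose! p hp hpe using hex
  have hset : {x ∈ Ioo (0:ℝ) 1 | Real.cos (φ x) = 0} = p '' (Finset.range k : Set ℕ) := by
    ext x
    constructor
    · rintro ⟨hx, hcx⟩
      obtain ⟨m, hm⟩ := Real.cos_eq_zero_iff.1 hcx
      have hxj : φ x = L (-m - 1) := by rw [hm]; simp only [L]; push_cast; ring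
      have hlt : φ x < Real.pi / 2 := by
        have := hcross (-1) le_rfl hx.1 hx.2.le (by simp only [L]; push_cast; linarith [h0.2])
        simp only [L] at this; push_cast at this; linarith
      have hgt : φ 1 < φ x := by
        have := hcross (-m - 1) hx.1.le hx.2 le_rfl hxj.le
        rwa [← hxj] at this
      have hm0 : m < 0 := by
        by_contra! hm0
        have : (0:ℝ) ≤ m := by exact_mod_cast hm0
        nlinarith
      have hmk : -m - 1 < k := by
        by_contra! hmk
        have : (k:ℝ) ≤ -m - 1 := by exact_mod_cast hmk
        nlinarith
      obtain ⟨j, hj⟩ := Int.eq_ofNat_of_zero_le (show 0 ≤ -m - 1 by omega)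
      have hjk : j < k := by omega
      refine ⟨j, by simpa using hjk, ?_⟩
      have e : φ (p j) = φ x := by rw [hpe j hjk, hxj, hj]
      rcases lt_trichotomy (p j) x with hlt' | h | hlt'
      · have := hcross j (hp j hjk).1.le hlt' hx.2.le (hpe j hjk).le
        rw [← hpe j hjk, e] at this
        exact absurd this (lt_irrefl _)
      · exact h
      · have := hcross j hx.1.le hlt' (hp j hjk).2.le (by rw [← e, hpe j hjk])
        rw [← hpe j hjk] at this
        exact absurd this (lt_irrefl _)
    · rintro ⟨j, hj, rfl⟩
      have hjk : j < k := by simpa using hj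
      exact ⟨hp j hjk, hcos j _ (hpe j hjk)⟩
  refine ⟨by rw [hset]; exact (Finset.finite_toSet _).image _, ?_⟩
  rw [hset, InjOn.ncard_image, ncard_coe_finset, Finset.card_range]
  intro i hi j hj hij
  have hi' : i < k := by simpa using hi
  have hj' : j < k := by simpa using hj
  have h1 := hpe i hi'
  rw [hij, hpe j hj'] at h1
  simp only [L] at h1
  have : (j:ℝ) = i := by
    push_cast at h1
    have : Real.pi * ((j:ℝ) - i) = 0 := by linarith
    rcases mul_eq_zero.1 this with h | h
    · exact absurd h hpi.ne'
    · linarith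
  exact_mod_cast this.symm

lemma lt_of_eventually_right_lt {f : ℝ → ℝ} {a b : ℝ} (hab : a < b)
    (hf : ContinuousOn f (Icc a b)) (h : ∀ x ∈ Ico a b, ∀ᶠ t in nhdsWithin x (Ioi x), f t < f x) :
    f b < f a := by
  have key : ∀ c ∈ Ico a b, f b ≤ f c := by
    intro c hc
    refine le_of_forall_pos_le_add fun ε hε => ?_
    have hbc : 0 < b - c := sub_pos.2 hc.2
    have := image_le_of_liminf_slope_right_lt_deriv_boundary (f := f) (f' := fun _ => 0)
      (a := c) (b := b) (hf.mono (Icc_subset_Icc_left hc.1))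
      (fun x hx r hr => by
        refine Eventually.frequently ?_
        filter_upwards [h x ⟨hc.1.trans hx.1, hx.2⟩, self_mem_nhdsWithin] with t ht ht'
        refine lt_of_le_of_lt ?_ hr
        rw [slope_def_field]
        exact div_nonpos_of_nonpos_of_nonneg (by linarith) (by linarith [mem_Ioi.1 ht']))
      (B := fun x => f c + ε / (b - c) * (x - c)) (B' := fun _ => ε / (b - c))
      (by simp) (fun x => by
        simpa using (((hasDerivAt_id x).sub_const c).const_mul (ε / (b - c))).const_add (f c))
      (fun x _ _ => by positivity) (right_mem_Icc.2 hc.2.le)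
    rwa [div_mul_cancel₀ _ hbc.ne'] at this
  obtain ⟨c, h1, h2⟩ := ((h a (left_mem_Ico.2 hab)).and
    (Ioo_mem_nhdsGT hab)).exists
  exact (key c ⟨h2.1.le, h2.2⟩).trans_lt h1

end Polar

section Prufer

/-- A shooting family together with the polar angle `φ` of `(y', y'')`. -/
structure Prufer (P : ℝ → ℝ) (β : ℝ) (y y1 y2 z φ : ℝ → ℝ → ℝ) : Prop where
  sh : Shooting P β y y1 y2 z
  init : ∀ l, φ l 0 = Real.arctan β
  deriv : ∀ l, 0 ≤ l → ∀ x ∈ Icc (0:ℝ) 1,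
    HasDerivWithinAt (φ l) (rot (y1 l) (y2 l) (fun x => l * z l x) x) (Icc 0 1) x
  cont : ContinuousOn (fun l => φ l 1) (Ici 0)

variable {P : ℝ → ℝ} {β : ℝ} {y y1 y2 z φ : ℝ → ℝ → ℝ}

lemma Shooting.norm_pos (hP : Weight P) (h : Shooting P β y y1 y2 z) {l x : ℝ} (hl : 0 ≤ l)
    (hx : x ∈ Icc (0:ℝ) 1) : 0 < y1 l x ^ 2 + y2 l x ^ 2 := by
  rcases (h.sol l).ne_zero hP hl (h.z_zero l) (h.z_one l) (h.y_zero_neg l hl).ne hx with h1 | h1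
  · have := sq_nonneg (y2 l x); positivity
  · have := sq_nonneg (y1 l x); positivity

lemma exists_prufer (hP : Weight P) (hβ : 0 < β) :
    ∃ y y1 y2 z φ : ℝ → ℝ → ℝ, Prufer P β y y1 y2 z φ := by
  obtain ⟨y, y1, y2, z, h⟩ := exists_shooting hP hβ
  let q : ℝ × ℝ → ℝ × ℝ := fun p => (max p.1 0, (projIcc (0:ℝ) 1 zero_le_one p.2 : ℝ))
  have hq : Continuous q := (continuous_fst.max continuous_const).prodMk
    (continuous_subtype_val.comp (continuous_projIcc.comp continuous_snd))
  let r : ℝ × ℝ → ℝ := fun p => rot (y1 p.1) (y2 p.1) (fun x => p.1 * z p.1 x) p.2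
  have hr : Continuous (r ∘ q) := by
    have c1 := h.cy1.comp hq
    have c2 := h.cy2.comp hq
    have cz := h.cz.comp hq
    refine ((c1.mul ((continuous_fst.comp hq).mul cz)).sub (c2.pow 2)).div₀
      ((c1.pow 2).add (c2.pow 2)) fun p => ?_
    exact (h.norm_pos hP (le_max_right _ _) (projIcc (0:ℝ) 1 zero_le_one p.2).2).ne'
  refine ⟨y, y1, y2, z, fun l x => Real.arctan β + ∫ t in (0:ℝ)..x, (r ∘ q) (l, t),
    h, fun l => by simp, fun l hl x hx => ?_, ?_⟩
  · have hc : Continuous fun t => (r ∘ q) (l, t) := hr.comp (continuous_const.prodMk continuous_id)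
    have := ((hc.integral_hasStrictDerivAt 0 x).hasDerivAt.const_add
      (Real.arctan β)).hasDerivWithinAt (s := Icc (0:ℝ) 1)
    refine this.congr_deriv ?_
    simp only [Function.comp, q, r, max_eq_left hl, projIcc_of_mem zero_le_one hx]
  · exact (continuous_const.add (intervalIntegral.continuous_parametric_intervalIntegral_of_continuous'
      (f := fun l t => (r ∘ q) (l, t)) hr 0 1)).continuousOn

namespace Prufer

lemma polar (hP : Weight P) (h : Prufer P β y y1 y2 z φ) {l x : ℝ} (hl : 0 ≤ l)
    (hx : x ∈ Icc (0:ℝ) 1) :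
    y1 l x = √(y1 l x ^ 2 + y2 l x ^ 2) * Real.cos (φ l x) ∧
      y2 l x = √(y1 l x ^ 2 + y2 l x ^ 2) * Real.sin (φ l x) := by
  have hp := h.sh.y1_zero_pos l hl
  have e : √(y1 l 0 ^ 2 + y2 l 0 ^ 2) = y1 l 0 * √(1 + β ^ 2) := by
    rw [h.sh.bc_zero l, show y1 l 0 ^ 2 + (β * y1 l 0) ^ 2 = y1 l 0 ^ 2 * (1 + β ^ 2) by ring,
      Real.sqrt_mul (sq_nonneg _), Real.sqrt_sq hp.le]
  have hs : √(1 + β ^ 2) ≠ 0 := by positivity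
  refine CantorBeam.polar (h.sh.sol l).d1 (h.sh.sol l).d2 (fun x hx => h.sh.norm_pos hP hl hx)
    (h.deriv l hl) ?_ ?_ x hx
  · rw [e, h.init, Real.cos_arctan]
    field_simp
  · rw [e, h.init, Real.sin_arctan, h.sh.bc_zero l]
    field_simp

lemma sqrt_pos (hP : Weight P) (h : Prufer P β y y1 y2 z φ) {l x : ℝ} (hl : 0 ≤ l)
    (hx : x ∈ Icc (0:ℝ) 1) : 0 < √(y1 l x ^ 2 + y2 l x ^ 2) :=
  Real.sqrt_pos.2 (h.sh.norm_pos hP hl hx)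

lemma y1_eq_zero_iff (hP : Weight P) (h : Prufer P β y y1 y2 z φ) {l x : ℝ} (hl : 0 ≤ l)
    (hx : x ∈ Icc (0:ℝ) 1) : y1 l x = 0 ↔ Real.cos (φ l x) = 0 := by
  have h1 := (h.polar hP hl hx).1
  have h2 := (h.sqrt_pos hP hl hx).ne'
  constructor
  · intro e
    rw [e] at h1
    rcases mul_eq_zero.1 h1.symm with h3 | h3
    · rw [e] at h2; exact absurd h3 h2
    · exact h3
  · intro e
    rw [e, mul_zero] at h1
    exact h1

lemma rot_neg (hP : Weight P) (h : Prufer P β y y1 y2 z φ) {l x : ℝ} (hl : 0 ≤ l)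
    (hx : x ∈ Icc (0:ℝ) 1) (hc : Real.cos (φ l x) = 0) :
    rot (y1 l) (y2 l) (fun x => l * z l x) x < 0 := by
  have e := (h.y1_eq_zero_iff hP hl hx).2 hc
  have hn := h.sh.norm_pos hP hl hx
  rw [e] at hn
  have : 0 < y2 l x ^ 2 := by simpa using hn
  simp only [rot, e]
  refine div_neg_of_neg_of_pos ?_ hn
  linarith

lemma phi_zero_mem (h : Prufer P β y y1 y2 z φ) (l : ℝ) :
    φ l 0 ∈ Ioo (-(Real.pi / 2)) (Real.pi / 2) := by
  rw [h.init]; exact Real.arctan_mem_Ioo β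

lemma phi_one_lt (hP : Weight P) (h : Prufer P β y y1 y2 z φ) {l : ℝ} (hl : 0 ≤ l) :
    φ l 1 < Real.pi / 2 :=
  lt_of_level_decreasing (h.deriv l hl) (fun x hx e => h.rot_neg hP hl hx (by
    rw [e, Real.cos_pi_div_two])) le_rfl one_pos le_rfl (h.phi_zero_mem l).2.le

lemma phi_one_zero_pos (hP : Weight P) (hβ : 0 < β) (h : Prufer P β y y1 y2 z φ) :
    0 < φ 0 1 := by
  have hpos : ∀ x ∈ Icc (0:ℝ) 1, 0 < y2 0 x := by
    intro x hx
    have := le_of_hasDerivWithinAt_nonneg (h.sh.sol 0).d2 le_rfl hx.1 hx.2 (fun t _ => by simp)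
    have h0 := h.sh.y1_zero_pos 0 le_rfl
    rw [h.sh.bc_zero] at this
    exact (mul_pos hβ h0).trans_le this
  by_contra! hneg
  have h0 : 0 < φ 0 0 := by rw [h.init]; exact Real.arctan_pos.2 hβ
  have hc : ContinuousOn (φ 0) (Icc 0 1) := fun x hx => (h.deriv 0 le_rfl x hx).continuousWithinAt
  obtain ⟨x, hx, hxe⟩ := intermediate_value_Icc' zero_le_one hc ⟨hneg, h0.le⟩
  have h2 := hpos x hx
  rw [(h.polar hP le_rfl hx).2, hxe, Real.sin_zero, mul_zero] at h2
  exact lt_irrefl _ h2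

end Prufer

/-- Lagrange identity for two values of the spectral parameter. -/
lemma Sol.lagrange {l l' : ℝ} {y y1 y2 z u u1 u2 w : ℝ → ℝ}
    (h : Sol P l y y1 y2 z) (h' : Sol P l' u u1 u2 w) :
    IsPrimitive P (fun x => (l' - l) * (y x * u x))
      (fun x => (l' - l) * (y1 x * u x + y x * u1 x))
      (fun x => l' * (y x * w x) - l * (z x * u x) + y2 x * u1 x - y1 x * u2 x) := by
  intro x hx
  have a := (h.d0 x hx).mul (h'.dz x hx)
  have b := (h.dz x hx).mul (h'.d0 x hx)
  have c := (h.d2 x hx).mul (h'.d1 x hx)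
  have d := (h.d1 x hx).mul (h'.d2 x hx)
  refine (((((a.const_mul l').sub (b.const_mul l)).add c).sub d).congr_deriv ?_).congr_of_mem
    (fun t _ => ?_) hx
  · ring
  · simp only [Pi.add_apply, Pi.sub_apply, Pi.mul_apply]
    ring

lemma Shooting.eventually_cross_neg (hP : Weight P) (h : Shooting P β y y1 y2 z) {l : ℝ}
    (hl : 0 ≤ l) : ∀ᶠ l' in nhdsWithin l (Ioi l), y1 l 1 * y2 l' 1 - y2 l 1 * y1 l' 1 < 0 := by
  have hc : Continuous fun p : ℝ × ℝ => y l p.2 * y p.1 p.2 :=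
    (h.cy.comp (continuous_const.prodMk continuous_snd)).mul h.cy
  set m := y l 0 ^ 2 with hm
  have hm0 : 0 < m := sq_pos_of_neg (h.y_zero_neg l hl)
  have hcl : Continuous fun x => y l x ^ 2 :=
    (h.cy.comp (continuous_const.prodMk continuous_id)).pow 2
  obtain ⟨ε, hε, hball⟩ := Metric.eventually_nhds_iff.1
    (hcl.continuousAt.eventually (lt_mem_nhds (show m / 2 < y l 0 ^ 2 by linarith)))
  set δ := min (ε / 2) 1 with hδ
  have hδ0 : 0 < δ := by positivity
  have hδ1 : δ ≤ 1 := min_le_right _ _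
  have hsq : ∀ x ∈ Icc (0:ℝ) δ, m / 2 < y l x ^ 2 := fun x hx => hball (by
    rw [Real.dist_eq, sub_zero, abs_of_nonneg hx.1]
    have : δ ≤ ε / 2 := min_le_left _ _
    linarith [hx.2])
  have hp := hP.pos δ ⟨hδ0, hδ1⟩
  have ev1 : ∀ᶠ l' in nhds l, ∀ x ∈ Icc (0:ℝ) δ, m / 2 < y l x * y l' x :=
    isCompact_Icc.eventually_forall_of_forall_eventually fun x hx =>
      hc.continuousAt.eventually (lt_mem_nhds (by simpa [sq] using hsq x hx))
  have ev2 : ∀ᶠ l' in nhds l, ∀ x ∈ Icc (0:ℝ) 1, -(m * P δ / 4) < y l x * y l' x :=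
    isCompact_Icc.eventually_forall_of_forall_eventually fun x hx =>
      hc.continuousAt.eventually (lt_mem_nhds (by
        have h1 : 0 ≤ y l x * y l x := mul_self_nonneg _
        have h2 : 0 < m * P δ := mul_pos hm0 hp
        show -(m * P δ / 4) < y l x * y l x
        linarith))
  filter_upwards [ev1.filter_mono nhdsWithin_le_nhds, ev2.filter_mono nhdsWithin_le_nhds,
    self_mem_nhdsWithin] with l' h1 h2 hl'
  have hd : 0 < l' - l := sub_pos.2 hl'
  have hprim := (h.sol l).lagrange (h.sol l')
  have hf : ∀ x ∈ Icc (0:ℝ) 1, HasDerivWithinAt (fun x => (l' - l) * (y l x * y l' x))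
      ((l' - l) * (y1 l x * y l' x + y l x * y1 l' x)) (Icc 0 1) x := fun x hx =>
    (((h.sol l).d0 x hx).mul ((h.sol l').d0 x hx)).const_mul _
  have hf' : ContinuousOn (fun x => (l' - l) * (y1 l x * y l' x + y l x * y1 l' x)) (Icc 0 1) := by
    have := (h.sol l).c0
    have := (h.sol l).c1
    have := (h.sol l').c0
    have := (h.sol l').c1
    fun_prop
  have i1 := hprim.mul_sub_le hP.mono hf hf' le_rfl hδ0.le hδ1 (m := (l' - l) * (m / 2))
    (fun x hx => mul_le_mul_of_nonneg_left (h1 x hx).le hd.le)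
  have i2 := hprim.mul_sub_le hP.mono hf hf' hδ0.le hδ1 le_rfl (m := (l' - l) * (-(m * P δ / 4)))
    (fun x hx => mul_le_mul_of_nonneg_left (h2 x ⟨hδ0.le.trans hx.1, hx.2⟩).le hd.le)
  have hP1 := hP.le_one ⟨hδ0.le, hδ1⟩
  rw [hP.one] at i2
  rw [hP.zero] at i1
  simp only [h.z_zero, h.z_one, h.bc_zero, mul_zero, zero_mul] at i1 i2
  have i3 : 0 < (l' - l) * (m * P δ / 4) := mul_pos hd (by positivity)
  have i4 : (l' - l) * (-(m * P δ / 4)) ≤ (l' - l) * (-(m * P δ / 4)) * (1 - P δ) := by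
    nlinarith [mul_nonneg i3.le hp.le]
  nlinarith

namespace Prufer

/-- The final angle decreases strictly with the spectral parameter. -/
lemma strictAntiOn (hP : Weight P) (h : Prufer P β y y1 y2 z φ) :
    StrictAntiOn (fun l => φ l 1) (Ici 0) := by
  intro a ha b hb hab
  refine lt_of_eventually_right_lt (f := fun l => φ l 1) hab
    (h.cont.mono fun x hx => ha.out.trans hx.1) fun l hl => ?_
  have hl0 : 0 ≤ l := ha.out.trans hl.1
  have hcont : Tendsto (fun l => φ l 1) (nhdsWithin l (Ioi l)) (nhds (φ l 1)) :=
    (h.cont l hl0).mono_left (nhdsWithin_mono _ fun x hx => hl0.trans (le_of_lt hx))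
  filter_upwards [h.sh.eventually_cross_neg hP hl0, self_mem_nhdsWithin,
    hcont.eventually (Metric.ball_mem_nhds _ Real.pi_pos)] with l' h1 hl' h2
  have hl'0 : 0 ≤ l' := hl0.trans (le_of_lt hl')
  obtain ⟨a1, a2⟩ := h.polar hP hl0 one_mem01
  obtain ⟨b1, b2⟩ := h.polar hP hl'0 one_mem01
  have e : y1 l 1 * y2 l' 1 - y2 l 1 * y1 l' 1 = √(y1 l 1 ^ 2 + y2 l 1 ^ 2) *
      √(y1 l' 1 ^ 2 + y2 l' 1 ^ 2) * Real.sin (φ l' 1 - φ l 1) := by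
    rw [Real.sin_sub]
    linear_combination a1 * y2 l' 1 + √(y1 l 1 ^ 2 + y2 l 1 ^ 2) * Real.cos (φ l 1) * b2
      - a2 * y1 l' 1 - √(y1 l 1 ^ 2 + y2 l 1 ^ 2) * Real.sin (φ l 1) * b1
  rw [e] at h1
  have hr := mul_pos (h.sqrt_pos hP hl0 one_mem01) (h.sqrt_pos hP hl'0 one_mem01)
  have hs : Real.sin (φ l' 1 - φ l 1) < 0 := by
    by_contra! hcon
    exact absurd h1 (mul_nonneg hr.le hcon).not_gt
  by_contra! hcon
  rw [Real.dist_eq, abs_lt] at h2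
  exact absurd hs (Real.sin_nonneg_of_nonneg_of_le_pi (by linarith) (by linarith)).not_gt

end Prufer

end Prufer

section IntegerHits

variable {T : ℝ → ℝ}

lemma exists_hit (hc : ContinuousOn T (Ici 0)) (h0 : T 0 < 0) {l : ℝ} (hl : 0 ≤ l) {n : ℕ}
    (hn : (n:ℝ) ≤ T l) : ∃ μ, 0 < μ ∧ μ ≤ l ∧ T μ = n := by
  have hn0 : (0:ℝ) ≤ n := n.cast_nonneg
  obtain ⟨μ, hμ, e⟩ := intermediate_value_Icc hl (hc.mono fun x hx => hx.1)
    (show (n:ℝ) ∈ Icc (T 0) (T l) from ⟨by linarith, hn⟩)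
  refine ⟨μ, lt_of_le_of_ne hμ.1 ?_, hμ.2, e⟩
  rintro rfl
  linarith

lemma ncard_hits (hc : ContinuousOn T (Ici 0)) (hm : StrictMonoOn T (Ici 0)) (h0 : T 0 < 0)
    (h0' : -1 < T 0) {l : ℝ} (hl : 0 ≤ l) :
    {μ | 0 < μ ∧ μ ≤ l ∧ ∃ n : ℤ, T μ = n}.Finite ∧
      ({μ | 0 < μ ∧ μ ≤ l ∧ ∃ n : ℤ, T μ = n}.ncard : ℤ) = ⌊T l⌋ + 1 := by
  set S := {μ | 0 < μ ∧ μ ≤ l ∧ ∃ n : ℤ, T μ = n} with hS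
  have hinj : InjOn T S := hm.injOn.mono fun x hx => hx.1.le
  have himg : T '' S = (fun n : ℤ => (n : ℝ)) '' (Icc 0 ⌊T l⌋) := by
    ext r
    constructor
    · rintro ⟨μ, ⟨hμ0, hμl, n, hn⟩, rfl⟩
      refine ⟨n, ⟨?_, ?_⟩, hn.symm⟩
      · have h1 := hm (mem_Ici.2 le_rfl) (mem_Ici.2 hμ0.le) hμ0
        have : (-1:ℝ) < n := by rw [← hn]; linarith
        have : (-1:ℤ) < n := by exact_mod_cast this
        omega
      · rw [Int.le_floor, ← hn]
        exact hm.monotoneOn (mem_Ici.2 hμ0.le) (mem_Ici.2 hl) hμl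
    · rintro ⟨n, ⟨hn0, hn1⟩, rfl⟩
      obtain ⟨k, rfl⟩ := Int.eq_ofNat_of_zero_le hn0
      rw [Int.le_floor] at hn1
      obtain ⟨μ, h1, h2, h3⟩ := exists_hit hc h0 hl (n := k) (by simpa using hn1)
      exact ⟨μ, ⟨h1, h2, k, by simpa using h3⟩, by simpa using h3⟩
  have hfin : (T '' S).Finite := by rw [himg]; exact (finite_Icc _ _).image _
  refine ⟨Finite.of_finite_image hfin hinj, ?_⟩
  rw [← hinj.ncard_image, himg, (Int.cast_injective.injOn).ncard_image,
    ← Finset.coe_Icc, ncard_coe_finset, Int.card_Icc]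
  have : -1 ≤ ⌊T l⌋ := by
    rw [Int.le_floor]
    push_cast
    exact h0'.le.trans (hm.monotoneOn (mem_Ici.2 le_rfl) (mem_Ici.2 hl) hl)
  omega

end IntegerHits

section Counting

/-- `l` is an eigenvalue of the problem with `y''(0) = β₀ y'(0)`, `y''(1) = -β₁ y'(1)` and
vanishing third derivative at both ends. -/
def Mode (P : ℝ → ℝ) (β₀ β₁ l : ℝ) : Prop :=
  ∃ y y1 y2 z : ℝ → ℝ, Sol P l y y1 y2 z ∧ z 0 = 0 ∧ z 1 = 0 ∧ y2 0 = β₀ * y1 0 ∧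
    y2 1 = -(β₁ * y1 1) ∧ ∃ x ∈ Icc (0:ℝ) 1, y x ≠ 0

/-- Number of positive eigenvalues not exceeding `l`. -/
noncomputable def count (P : ℝ → ℝ) (β₀ β₁ l : ℝ) : ℕ :=
  {μ | 0 < μ ∧ μ ≤ l ∧ Mode P β₀ β₁ μ}.ncard

variable {P : ℝ → ℝ} {β β₁ l : ℝ}

lemma Mode.swap (hP : Weight P) (h : Mode P β β₁ l) : Mode P β₁ β l := by
  obtain ⟨y, y1, y2, z, h, h0, h1, b0, b1, x, hx, hyx⟩ := h
  exact ⟨_, _, _, _, h.reflect hP, by simp [h1], by simp [h0], by simp [b1], by simp [b0],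
    1 - x, one_sub_mem hx, by simpa⟩

lemma mode_comm (hP : Weight P) : Mode P β β₁ l ↔ Mode P β₁ β l :=
  ⟨fun h => h.swap hP, fun h => h.swap hP⟩

lemma count_comm (hP : Weight P) : count P β β₁ l = count P β₁ β l := by
  simp only [count, mode_comm hP (β := β)]

/-- Solutions of the left boundary problem are unique up to a factor. -/
lemma Shooting.proportional (hP : Weight P) (hβ : 0 < β) {y y1 y2 z : ℝ → ℝ → ℝ}
    (h : Shooting P β y y1 y2 z) (hl : 0 ≤ l) {u u1 u2 w : ℝ → ℝ} (hu : Sol P l u u1 u2 w)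
    (w0 : w 0 = 0) (w1 : w 1 = 0) (b0 : u2 0 = β * u1 0) :
    ∃ c : ℝ, ∀ x ∈ Icc (0:ℝ) 1, u x = c * y l x ∧ u1 x = c * y1 l x ∧ u2 x = c * y2 l x := by
  set c := u1 0 / y1 l 0 with hc
  have hy1 := (h.y1_zero_pos l hl).ne'
  have hs := hu.lin (h.sol l) 1 (-c)
  have e1 : 1 * u1 0 + -c * y1 l 0 = 0 := by rw [hc]; field_simp; ring
  have e2 : 1 * u2 0 + -c * y2 l 0 = β * (1 * u1 0 + -c * y1 l 0) := by
    rw [b0, h.bc_zero]; ring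
  have e0 : 1 * u 0 + -c * y l 0 = 0 := by
    by_contra hne
    exact (hs.init_ne hP hl hβ (by simp [w0, h.z_zero]) (by simp [w1, h.z_one]) e2
      ⟨0, zero_mem01, hne⟩).2 e1
  refine ⟨c, fun x hx => ?_⟩
  obtain ⟨a, b, d, -⟩ := hs.eq_zero hP zero_mem01 e0 e1 (by rw [e2, e1, mul_zero])
    (by simp [w0, h.z_zero]) x hx
  exact ⟨by linarith, by linarith, by linarith⟩

/-- Normalized final angle: the eigenvalues are the points where it is an integer. -/
noncomputable def level (φ : ℝ → ℝ → ℝ) (β₁ l : ℝ) : ℝ :=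
  -(φ l 1 + Real.arctan β₁) / Real.pi

section

variable {y y1 y2 z φ : ℝ → ℝ → ℝ}

lemma Prufer.level_cont (h : Prufer P β y y1 y2 z φ) : ContinuousOn (level φ β₁) (Ici 0) :=
  ((h.cont.add continuousOn_const).neg).div_const _

lemma Prufer.level_mono (hP : Weight P) (h : Prufer P β y y1 y2 z φ) :
    StrictMonoOn (level φ β₁) (Ici 0) := fun a ha b hb hab => by
  have := h.strictAntiOn hP ha hb hab
  simp only [level]
  gcongr

lemma Prufer.level_zero_neg (hP : Weight P) (hβ : 0 < β) (hβ₁ : 0 < β₁)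
    (h : Prufer P β y y1 y2 z φ) : level φ β₁ 0 < 0 := by
  have h1 := h.phi_one_zero_pos hP hβ
  have h2 := Real.arctan_pos.2 hβ₁
  exact div_neg_of_neg_of_pos (by linarith) Real.pi_pos

lemma Prufer.neg_one_lt_level (hP : Weight P) (h : Prufer P β y y1 y2 z φ) (hl : 0 ≤ l) :
    -1 < level φ β₁ l := by
  have h1 := h.phi_one_lt hP hl
  have h2 := Real.arctan_lt_pi_div_two β₁
  rw [level, lt_div_iff₀ Real.pi_pos]
  linarith

lemma Prufer.mode_iff (hP : Weight P) (hβ : 0 < β) (h : Prufer P β y y1 y2 z φ) (hl : 0 ≤ l) :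
    Mode P β β₁ l ↔ ∃ n : ℤ, level φ β₁ l = n := by
  have h1 : Mode P β β₁ l ↔ y2 l 1 = -(β₁ * y1 l 1) := by
    constructor
    · rintro ⟨u, u1, u2, w, hu, w0, w1, b0, b1, x, hx, hux⟩
      obtain ⟨c, hc⟩ := h.sh.proportional hP hβ hl hu w0 w1 b0
      have hc0 : c ≠ 0 := by
        rintro rfl
        exact hux (by rw [(hc x hx).1, zero_mul])
      rw [(hc 1 one_mem01).2.1, (hc 1 one_mem01).2.2] at b1
      refine mul_left_cancel₀ hc0 ?_
      rw [b1]; ring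
    · intro e
      exact ⟨_, _, _, _, h.sh.sol l, h.sh.z_zero l, h.sh.z_one l, h.sh.bc_zero l, e, 0, zero_mem01,
        (h.sh.y_zero_neg l hl).ne⟩
  obtain ⟨p1, p2⟩ := h.polar hP hl one_mem01
  have hr := (h.sqrt_pos hP hl one_mem01).ne'
  set r := √(y1 l 1 ^ 2 + y2 l 1 ^ 2)
  have h2 : y2 l 1 = -(β₁ * y1 l 1) ↔ Real.sin (φ l 1 + Real.arctan β₁) = 0 := by
    rw [Real.sin_add, Real.cos_arctan, Real.sin_arctan, p1, p2]
    have hs : √(1 + β₁ ^ 2) ≠ 0 := by positivity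
    field_simp
    constructor
    · intro e; rw [e]; ring
    · intro e; linarith
  rw [h1, h2, Real.sin_eq_zero_iff]
  constructor
  · rintro ⟨n, hn⟩
    refine ⟨-n, ?_⟩
    rw [level, ← hn]
    have := Real.pi_pos.ne'
    push_cast
    field_simp
  · rintro ⟨n, hn⟩
    refine ⟨-n, ?_⟩
    rw [level, div_eq_iff Real.pi_pos.ne'] at hn
    push_cast
    linarith

lemma Prufer.count_eq (hP : Weight P) (hβ : 0 < β) (hβ₁ : 0 < β₁)
    (h : Prufer P β y y1 y2 z φ) (hl : 0 ≤ l) :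
    {μ | 0 < μ ∧ μ ≤ l ∧ Mode P β β₁ μ}.Finite ∧ (count P β β₁ l : ℤ) = ⌊level φ β₁ l⌋ + 1 := by
  have e : {μ | 0 < μ ∧ μ ≤ l ∧ Mode P β β₁ μ} =
      {μ | 0 < μ ∧ μ ≤ l ∧ ∃ n : ℤ, level φ β₁ μ = n} := by
    ext μ
    simp only [mem_ofPred_eq]
    exact and_congr_right fun hμ => and_congr_right fun _ => h.mode_iff hP hβ hμ.le
  rw [count, e]
  exact ncard_hits h.level_cont (h.level_mono hP) (h.level_zero_neg hP hβ hβ₁)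
    (h.neg_one_lt_level hP le_rfl) hl

end

lemma finite_modes (hP : Weight P) (hβ : 0 < β) (hβ₁ : 0 < β₁) (hl : 0 ≤ l) :
    {μ | 0 < μ ∧ μ ≤ l ∧ Mode P β β₁ μ}.Finite := by
  obtain ⟨_, _, _, _, _, h⟩ := exists_prufer hP hβ
  exact (h.count_eq hP hβ hβ₁ hl).1

lemma count_mono (hP : Weight P) (hβ : 0 < β) (hβ₁ : 0 < β₁) {l' : ℝ} (hl : 0 ≤ l)
    (hll : l ≤ l') : count P β β₁ l ≤ count P β β₁ l' :=
  ncard_le_ncard (fun _ hx => ⟨hx.1, hx.2.1.trans hll, hx.2.2⟩)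
    (finite_modes hP hβ hβ₁ (hl.trans hll))

lemma count_lt (hP : Weight P) (hβ : 0 < β) (hβ₁ : 0 < β₁) {l' : ℝ} (hl : 0 ≤ l)
    (hll : l < l') (hm : Mode P β β₁ l') : count P β β₁ l < count P β β₁ l' :=
  ncard_lt_ncard ⟨fun _ hx => ⟨hx.1, hx.2.1.trans hll.le, hx.2.2⟩,
    fun hsub => (hsub ⟨hl.trans_lt hll, le_rfl, hm⟩).2.1.not_gt hll⟩
    (finite_modes hP hβ hβ₁ (hl.trans hll.le))

/-- Every value up to the current count is attained at an eigenvalue. -/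
lemma exists_mode_count_eq (hP : Weight P) (hβ : 0 < β) (hβ₁ : 0 < β₁) (hl : 0 ≤ l) {m : ℕ}
    (hm : 1 ≤ m) (hml : m ≤ count P β β₁ l) :
    ∃ μ, 0 < μ ∧ μ ≤ l ∧ Mode P β β₁ μ ∧ count P β β₁ μ = m := by
  obtain ⟨_, _, _, _, φ, h⟩ := exists_prufer hP hβ
  have h1 := (h.count_eq hP hβ hβ₁ hl).2
  have h2 : ((m - 1 : ℕ) : ℝ) ≤ level φ β₁ l := by
    have : ((m - 1 : ℕ) : ℤ) ≤ ⌊level φ β₁ l⌋ := by omega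
    rw [Int.le_floor] at this
    exact_mod_cast this
  obtain ⟨μ, h3, h4, h5⟩ := exists_hit h.level_cont (h.level_zero_neg hP hβ hβ₁) hl h2
  refine ⟨μ, h3, h4, (h.mode_iff hP hβ h3.le).2 ⟨(m - 1 : ℕ), by simpa using h5⟩, ?_⟩
  have h6 := (h.count_eq hP hβ hβ₁ h3.le).2
  rw [h5, Int.floor_natCast] at h6
  omega

/-- The number of interior zeros of `y'` locates the eigenvalue. -/
lemma ncard_zeros (hP : Weight P) (hβ : 0 < β) (hβ₁ : 0 < β₁) (hl : 0 ≤ l) {u u1 u2 w : ℝ → ℝ}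
    (hu : Sol P l u u1 u2 w) (w0 : w 0 = 0) (w1 : w 1 = 0) (b0 : u2 0 = β * u1 0)
    (b1 : u2 1 = -(β₁ * u1 1)) (hnt : ∃ x ∈ Icc (0:ℝ) 1, u x ≠ 0) :
    {x ∈ Ioo (0:ℝ) 1 | u1 x = 0}.Finite ∧
      {x ∈ Ioo (0:ℝ) 1 | u1 x = 0}.ncard + 1 = count P β β₁ l := by
  obtain ⟨y, y1, y2, z, φ, h⟩ := exists_prufer hP hβ
  obtain ⟨n, hn⟩ := (h.mode_iff hP hβ hl).1 ⟨u, u1, u2, w, hu, w0, w1, b0, b1, hnt⟩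
  have hn0 : 0 ≤ n := by
    have h1 := h.neg_one_lt_level hP (β₁ := β₁) hl
    rw [hn] at h1
    have : (-1:ℤ) < n := by exact_mod_cast h1
    omega
  obtain ⟨k, rfl⟩ := Int.eq_ofNat_of_zero_le hn0
  obtain ⟨c, hc⟩ := h.sh.proportional hP hβ hl hu w0 w1 b0
  have hc0 : c ≠ 0 := by
    rintro rfl
    obtain ⟨x, hx, hux⟩ := hnt
    exact hux (by rw [(hc x hx).1, zero_mul])
  have hset : {x ∈ Ioo (0:ℝ) 1 | u1 x = 0} = {x ∈ Ioo (0:ℝ) 1 | Real.cos (φ l x) = 0} := by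
    ext x
    refine and_congr_right fun hx => ?_
    have hx' := Ioo_subset_Icc_self hx
    rw [(hc x hx').2.1, ← h.y1_eq_zero_iff hP hl hx', mul_eq_zero, or_iff_right hc0]
  have hθ : φ l 1 = -Real.arctan β₁ - Real.pi * k := by
    rw [level, div_eq_iff Real.pi_pos.ne'] at hn
    push_cast at hn
    linarith
  have hz := ncard_zeros_cos (k := k) (h.deriv l hl) (fun x hx => h.rot_neg hP hl hx)
    (h.phi_zero_mem l) (by rw [hθ]; linarith [Real.arctan_lt_pi_div_two β₁])
    (by rw [hθ]; linarith [Real.neg_pi_div_two_lt_arctan β₁])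
  rw [hset]
  refine ⟨hz.1, ?_⟩
  have h6 := (h.count_eq hP hβ hβ₁ hl).2
  rw [hn, Int.floor_intCast] at h6
  rw [hz.2]
  exact_mod_cast h6.symm

lemma count_right_bounds (hP : Weight P) (hβ : 0 < β) (hβ₁ : 0 < β₁) {β₂ : ℝ} (h12 : β₁ ≤ β₂)
    (hl : 0 ≤ l) :
    count P β β₂ l ≤ count P β β₁ l ∧ count P β β₁ l ≤ count P β β₂ l + 1 := by
  obtain ⟨y, y1, y2, z, φ, h⟩ := exists_prufer hP hβ
  have c1 := (h.count_eq hP hβ hβ₁ hl).2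
  have c2 := (h.count_eq hP hβ (hβ₁.trans_le h12) hl).2
  have hpi := Real.pi_pos
  have a1 : level φ β₂ l ≤ level φ β₁ l := by
    simp only [level]
    have := Real.arctan_strictMono.monotone h12
    gcongr
  have a2 : level φ β₁ l ≤ level φ β₂ l + 1 := by
    have h1 := Real.arctan_lt_pi_div_two β₂
    have h2 := Real.arctan_pos.2 hβ₁
    simp only [level]
    rw [div_add_one hpi.ne']
    gcongr
    linarith
  have b1 := Int.floor_mono a1
  have b2 := Int.floor_mono a2
  rw [Int.floor_add_one] at b2
  constructor <;> omega

/-- Comparison of the counts for two different boundary parameters. -/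
lemma count_diag_bounds (hP : Weight P) (hβ : 0 < β) {β' : ℝ} (hββ : β ≤ β') (hl : 0 ≤ l) :
    count P β' β' l ≤ count P β β l ∧ count P β β l ≤ count P β' β' l + 2 := by
  have h1 := count_right_bounds hP hβ hβ hββ hl
  have h2 := count_right_bounds hP (hβ.trans_le hββ) hβ hββ hl
  have h3 : count P β' β l = count P β β' l := count_comm hP
  omega

end Counting

/-- Self-similar weights: `κ` pieces of length `a` separated by gaps of length `b`. -/
structure SelfSim (P : ℝ → ℝ) (κ : ℕ) (a b : ℝ) : Prop where
  weight : Weight P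
  two_le : 2 ≤ κ
  a_pos : 0 < a
  b_pos : 0 < b
  total : κ * a + (κ - 1) * b = 1
  piece : ∀ k : ℕ, k < κ → ∀ x ∈ Icc (0:ℝ) 1, P (k * (a + b) + a * x) = (P x + k) / κ
  gap : ∀ k : ℕ, k + 1 < κ → ∀ x ∈ Icc (k * (a + b) + a) ((k + 1) * (a + b)),
    P x = (k + 1) / κ

lemma eq_of_hasDerivWithinAt_zero {f f' : ℝ → ℝ} {s t : ℝ}
    (hf : ∀ x ∈ Icc (0:ℝ) 1, HasDerivWithinAt f (f' x) (Icc 0 1) x)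
    (hs : 0 ≤ s) (hst : s ≤ t) (ht : t ≤ 1) (h0 : ∀ x ∈ Icc s t, f' x = 0) : f t = f s := by
  have h1 := le_of_hasDerivWithinAt_nonneg hf hs hst ht fun x hx => (h0 x hx).ge
  have h2 := le_of_hasDerivWithinAt_nonneg (fun x hx => (hf x hx).neg) hs hst ht
    fun x hx => (neg_eq_zero.2 (h0 x hx)).ge
  simp only [Pi.neg_apply] at h2
  linarith

section Gluing

variable {P : ℝ → ℝ} {κ : ℕ} {a b : ℝ}

namespace SelfSim

lemma piece_end_le (hS : SelfSim P κ a b) {j : ℕ} (hj : j < κ) : j * (a + b) + a ≤ 1 := by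
  have h1 : (j:ℝ) + 1 ≤ κ := by exact_mod_cast hj
  nlinarith [hS.total, hS.a_pos, hS.b_pos]

lemma piece_mem (hS : SelfSim P κ a b) {j : ℕ} (hj : j < κ) {x : ℝ} (hx : x ∈ Icc (0:ℝ) 1) :
    j * (a + b) + a * x ∈ Icc (0:ℝ) 1 := by
  have h1 := hS.piece_end_le hj
  have h2 := hS.a_pos
  have h3 := hS.b_pos
  have hx0 := hx.1
  exact ⟨by positivity, by nlinarith [hx.2]⟩

lemma gap_end_le (hS : SelfSim P κ a b) {j : ℕ} (hj : j + 1 < κ) : ((j:ℝ) + 1) * (a + b) ≤ 1 := by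
  have := (hS.piece_mem hj zero_mem01).2
  push_cast at this
  linarith

lemma last (hS : SelfSim P κ a b) : ((κ - 1 : ℕ) : ℝ) * (a + b) + a = 1 := by
  rw [Nat.cast_sub (by have := hS.two_le; omega)]
  push_cast
  linarith [hS.total]

end SelfSim

variable {l l' : ℝ} {y y1 y2 z : ℝ → ℝ}

/-- Restriction of a solution to one piece of the self-similar structure. -/
lemma Sol.rescale (hS : SelfSim P κ a b) (hl : a ^ 3 * l' = κ * l) (h : Sol P l' y y1 y2 z)
    {j : ℕ} (hj : j < κ) :
    Sol P l (fun x => y (j * (a + b) + a * x)) (fun x => a * y1 (j * (a + b) + a * x))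
      (fun x => a ^ 2 * y2 (j * (a + b) + a * x)) (fun x => κ * z (j * (a + b) + a * x)) := by
  have hκ : (κ:ℝ) ≠ 0 := by have := hS.two_le; positivity
  have key : ∀ (f : ℝ → ℝ) (d x : ℝ), x ∈ Icc (0:ℝ) 1 →
      HasDerivWithinAt f d (Icc 0 1) (j * (a + b) + a * x) →
      HasDerivWithinAt (fun x => f (j * (a + b) + a * x)) (a * d) (Icc 0 1) x := by
    intro f d x hx hf
    have h1 : HasDerivWithinAt (fun x : ℝ => j * (a + b) + a * x) a (Icc 0 1) x := by
      simpa using ((hasDerivWithinAt_id x (Icc (0:ℝ) 1)).const_mul a).const_add (j * (a + b))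
    have := hf.comp x h1 (fun t ht => hS.piece_mem hj ht)
    simpa [Function.comp_def, mul_comm] using this
  refine ⟨fun x hx => key _ _ x hx (h.d0 _ (hS.piece_mem hj hx)), fun x hx => ?_, fun x hx => ?_,
    fun x hx => ?_⟩
  · exact ((key _ _ x hx (h.d1 _ (hS.piece_mem hj hx))).const_mul a).congr_deriv (by ring)
  · exact ((key _ _ x hx (h.d2 _ (hS.piece_mem hj hx))).const_mul (a ^ 2)).congr_deriv (by
      linear_combination z (j * (a + b) + a * x) * hl)
  · have h1 := (key _ _ x hx (h.dz _ (hS.piece_mem hj hx))).const_mul (κ:ℝ)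
    have h2 := (key _ _ x hx (h.d0 _ (hS.piece_mem hj hx))).const_mul (j:ℝ)
    refine ((h1.add h2).congr_deriv ?_).congr_of_mem (fun t ht => ?_) hx
    · rw [hS.piece j hj x hx]; field_simp; ring
    · simp only [Pi.add_apply]
      rw [hS.piece j hj t ht]; field_simp; ring

/-- Solutions are polynomials of degree two on gaps where the force vanishes. -/
lemma Sol.on_gap (h : Sol P l y y1 y2 z) {p s t : ℝ} (hs : 0 ≤ s) (ht : t ≤ 1)
    (hp : ∀ x ∈ Icc s t, P x = p) (hz : z s = 0) :
    ∀ x ∈ Icc s t, y x = y s + y1 s * (x - s) + y2 s * (x - s) ^ 2 / 2 ∧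
      y1 x = y1 s + y2 s * (x - s) ∧ y2 x = y2 s ∧ z x = 0 := by
  have hz0 : ∀ x ∈ Icc s t, z x = 0 := fun x hx => by
    have := eq_of_hasDerivWithinAt_zero
      (fun x hx => (h.dz x hx).add ((h.d0 x hx).const_mul p)) hs hx.1 (hx.2.trans ht)
      (fun r hr => by rw [hp r ⟨hr.1, hr.2.trans hx.2⟩]; ring)
    simp only [Pi.add_apply, hp x hx, hp s ⟨le_rfl, hx.1.trans hx.2⟩, hz] at this
    linarith
  have h2 : ∀ x ∈ Icc s t, y2 x = y2 s := fun x hx =>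
    eq_of_hasDerivWithinAt_zero h.d2 hs hx.1 (hx.2.trans ht)
      (fun r hr => by rw [hz0 r ⟨hr.1, hr.2.trans hx.2⟩, mul_zero])
  have h1 : ∀ x ∈ Icc s t, y1 x = y1 s + y2 s * (x - s) := fun x hx => by
    have := eq_of_hasDerivWithinAt_zero
      (fun x hx => (h.d1 x hx).sub ((hasDerivWithinAt_id x _).const_mul (y2 s))) hs hx.1
      (hx.2.trans ht) (fun r hr => by rw [h2 r ⟨hr.1, hr.2.trans hx.2⟩]; ring)
    simp only [Pi.sub_apply, id] at this
    linarith
  refine fun x hx => ⟨?_, h1 x hx, h2 x hx, hz0 x hx⟩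
  have := eq_of_hasDerivWithinAt_zero
    (fun x hx => (h.d0 x hx).sub ((((hasDerivWithinAt_id x (Icc (0:ℝ) 1)).sub_const s).const_mul
      (y1 s)).add (((((hasDerivWithinAt_id x (Icc (0:ℝ) 1)).sub_const s).pow 2).const_mul
      (y2 s / 2))))) hs hx.1
    (hx.2.trans ht) (fun r hr => by rw [h1 r ⟨hr.1, hr.2.trans hx.2⟩]; simp; ring)
  simp at this
  linarith

/-- Eigenfunctions of the symmetric problem are even or odd about the midpoint. -/
lemma exists_parity (hP : Weight P) {β : ℝ} (hβ : 0 < β) (hl : 0 ≤ l) (h : Sol P l y y1 y2 z)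
    (z0 : z 0 = 0) (z1 : z 1 = 0) (b0 : y2 0 = β * y1 0) (b1 : y2 1 = -(β * y1 1))
    (hnt : ∃ x ∈ Icc (0:ℝ) 1, y x ≠ 0) :
    ∃ c : ℝ, c ≠ 0 ∧ y 1 = c * y 0 ∧ y1 1 = -(c * y1 0) ∧ y2 1 = c * y2 0 := by
  obtain ⟨x₀, hx₀, hyx₀⟩ := hnt
  obtain ⟨u, u1, u2, w, hu⟩ := exists_shooting hP hβ
  obtain ⟨c, hc⟩ := hu.proportional hP hβ hl h z0 z1 b0
  obtain ⟨d, hd⟩ := hu.proportional hP hβ hl (h.reflect hP) (by simp [z1]) (by simp [z0])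
    (by simp [b1])
  have hc0 : c ≠ 0 := by
    rintro rfl
    exact hyx₀ (by rw [(hc x₀ hx₀).1, zero_mul])
  have hd0 : d ≠ 0 := by
    rintro rfl
    have := (hd (1 - x₀) (one_sub_mem hx₀)).1
    simp at this
    exact hyx₀ this
  obtain ⟨c1, c2, c3⟩ := hc 0 zero_mem01
  obtain ⟨d1, d2, d3⟩ := hd 0 zero_mem01
  rw [sub_zero] at d1 d2 d3
  refine ⟨d / c, div_ne_zero hd0 hc0, ?_, ?_, ?_⟩
  · rw [d1, c1]; field_simp
  · rw [← neg_eq_iff_eq_neg, d2, c2]; field_simp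
  · rw [d3, c3]; field_simp

/-- An eigenfunction with parameter `2 * a / b` is spread over all pieces of the self-similar structure,
producing an eigenfunction with parameter `2/b` and `κ` times its spectral number. -/
lemma mode_glue (hS : SelfSim P κ a b) (hl : 0 < l) (hll : a ^ 3 * l' = κ * l)
    (hm : Mode P (2 * a / b) (2 * a / b) l) :
    Mode P (2 / b) (2 / b) l' ∧
      count P (2 / b) (2 / b) l' = κ * count P (2 * a / b) (2 * a / b) l := by
  have hP := hS.weight
  have ha := hS.a_pos
  have hb := hS.b_pos
  have hκ : 2 ≤ κ := hS.two_le
  have hκ0 : (κ:ℝ) ≠ 0 := by positivity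
  have hβ : 0 < 2 * a / b := by positivity
  have hβ' : 0 < 2 / b := by positivity
  have hl' : 0 < l' := by
    have : 0 < a ^ 3 * l' := by rw [hll]; positivity
    exact pos_of_mul_pos_right this (by positivity)
  obtain ⟨y, y1, y2, z, h, z0, z1, b0, b1, hnt⟩ := hm
  obtain ⟨hy0, hy10⟩ := h.init_ne hP hl.le hβ z0 z1 b0 hnt
  obtain ⟨c, hc, p0, p1, p2⟩ := exists_parity hP hβ hl.le h z0 z1 b0 b1 hnt
  obtain ⟨Y, Y1, Y2, Z, H, I0, I1, I2, I3⟩ := exists_sol hP l' ![y 0, y1 0 / a, y2 0 / a ^ 2, 0]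
  simp only [Matrix.cons_val] at I0 I1 I2 I3
  let X : ℕ → ℝ := fun j => j * (a + b)
  have piece : ∀ j : ℕ, j < κ → Y (X j) = c ^ j * y 0 → Y1 (X j) = c ^ j * (y1 0 / a) →
      Y2 (X j) = c ^ j * (y2 0 / a ^ 2) → Z (X j) = 0 → ∀ x ∈ Icc (0:ℝ) 1,
      Y (X j + a * x) = c ^ j * y x ∧ a * Y1 (X j + a * x) = c ^ j * y1 x ∧
      a ^ 2 * Y2 (X j + a * x) = c ^ j * y2 x ∧ κ * Z (X j + a * x) = c ^ j * z x := by
    intro j hj e0 e1 e2 e3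
    refine (H.rescale hS hll hj).eq_of_init hP (h.smul (c ^ j)) ?_ ?_ ?_ ?_
    · rw [mul_zero, add_zero]; exact e0
    · simp only [mul_zero, add_zero]
      refine (congrArg (a * ·) e1).trans ?_
      field_simp
    · simp only [mul_zero, add_zero]
      refine (congrArg (a ^ 2 * ·) e2).trans ?_
      field_simp
    · simp only [mul_zero, add_zero, z0]
      refine (congrArg ((κ:ℝ) * ·) e3).trans ?_
      simp
  have piece_end : ∀ j : ℕ, (∀ x ∈ Icc (0:ℝ) 1,
      Y (X j + a * x) = c ^ j * y x ∧ a * Y1 (X j + a * x) = c ^ j * y1 x ∧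
      a ^ 2 * Y2 (X j + a * x) = c ^ j * y2 x ∧ κ * Z (X j + a * x) = c ^ j * z x) →
      Y (X j + a) = c ^ (j + 1) * y 0 ∧ Y1 (X j + a) = -(c ^ (j + 1) * (y1 0 / a)) ∧
      Y2 (X j + a) = c ^ (j + 1) * (y2 0 / a ^ 2) ∧ Z (X j + a) = 0 := by
    intro j hj
    obtain ⟨e0, e1, e2, e3⟩ := hj 1 one_mem01
    rw [mul_one] at e0 e1 e2 e3
    refine ⟨by rw [e0, p0]; ring, ?_, ?_, ?_⟩
    · rw [p1] at e1
      field_simp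
      linear_combination e1
    · rw [p2] at e2
      field_simp
      linear_combination e2
    · rw [z1, mul_zero] at e3
      exact (mul_eq_zero.1 e3).resolve_left hκ0
  have gap : ∀ j : ℕ, j + 1 < κ → (Y (X j + a) = c ^ (j + 1) * y 0 ∧
      Y1 (X j + a) = -(c ^ (j + 1) * (y1 0 / a)) ∧
      Y2 (X j + a) = c ^ (j + 1) * (y2 0 / a ^ 2) ∧ Z (X j + a) = 0) →
      ∀ x ∈ Icc (X j + a) (X (j + 1)),
      Y x = c ^ (j + 1) * y 0 + c ^ (j + 1) * (y1 0 / a) * ((x - (X j + a)) ^ 2 / b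
        - (x - (X j + a))) ∧
      Y1 x = c ^ (j + 1) * (y1 0 / a) * (2 * (x - (X j + a)) / b - 1) ∧
      Y2 x = c ^ (j + 1) * (y2 0 / a ^ 2) ∧ Z x = 0 := by
    rintro j hj ⟨e0, e1, e2, e3⟩ x hx
    have hX : X (j + 1) = ((j:ℝ) + 1) * (a + b) := by simp only [X]; push_cast; ring
    obtain ⟨g0, g1, g2, g3⟩ := H.on_gap (s := X j + a) (t := X (j + 1))
      (by simp only [X]; positivity) (by rw [hX]; exact hS.gap_end_le hj)
      (fun x hx => hS.gap j hj x (by rw [← hX]; exact hx)) e3 x hx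
    rw [e0, e1, e2, b0] at g0
    rw [e1, e2, b0] at g1
    refine ⟨?_, ?_, g2.trans e2, g3⟩
    · rw [g0]; field_simp; ring
    · rw [g1]; field_simp; ring
  have hXb : ∀ j, X (j + 1) - (X j + a) = b := fun j => by simp only [X]; push_cast; ring
  have main : ∀ j : ℕ, j < κ → Y (X j) = c ^ j * y 0 ∧ Y1 (X j) = c ^ j * (y1 0 / a) ∧
      Y2 (X j) = c ^ j * (y2 0 / a ^ 2) ∧ Z (X j) = 0 := by
    intro j
    induction j with
    | zero => intro _; simp [X, I0, I1, I2, I3]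
    | succ j ih =>
      intro hj
      obtain ⟨e0, e1, e2, e3⟩ := ih (by omega)
      obtain ⟨g0, g1, g2, g3⟩ := gap j hj (piece_end j (piece j (by omega) e0 e1 e2 e3))
        (X (j + 1)) ⟨by linarith [hXb j], le_rfl⟩
      rw [hXb] at g0 g1
      refine ⟨?_, ?_, g2, g3⟩
      · rw [g0]; field_simp; ring
      · rw [g1]; field_simp; ring
  have hpc : ∀ j : ℕ, j < κ → ∀ x ∈ Icc (0:ℝ) 1,
      Y (X j + a * x) = c ^ j * y x ∧ a * Y1 (X j + a * x) = c ^ j * y1 x ∧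
      a ^ 2 * Y2 (X j + a * x) = c ^ j * y2 x ∧ κ * Z (X j + a * x) = c ^ j * z x :=
    fun j hj => by
      obtain ⟨e0, e1, e2, e3⟩ := main j hj
      exact piece j hj e0 e1 e2 e3
  have hlast : X (κ - 1) + a = 1 := hS.last
  obtain ⟨f0, f1, f2, f3⟩ := piece_end (κ - 1) (hpc (κ - 1) (by omega))
  rw [hlast] at f0 f1 f2 f3
  have B0 : Y2 0 = 2 / b * Y1 0 := by rw [I1, I2, b0]; field_simp
  have B1 : Y2 1 = -(2 / b * Y1 1) := by rw [f1, f2, b0]; field_simp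
  have hNT : ∃ x ∈ Icc (0:ℝ) 1, Y x ≠ 0 := ⟨0, zero_mem01, by rwa [I0]⟩
  refine ⟨⟨Y, Y1, Y2, Z, H, I3, f3, B0, B1, hNT⟩, ?_⟩
  have N1 := ncard_zeros hP hβ hβ hl.le h z0 z1 b0 b1 hnt
  have N2 := ncard_zeros hP hβ' hβ' hl'.le H I3 f3 B0 B1 hNT
  set K := {x ∈ Ioo (0:ℝ) 1 | y1 x = 0} with hK
  have hXa : ∀ j, 0 ≤ X j := fun j => by simp only [X]; positivity
  have hpiece_count : ∀ j : ℕ, j < κ → {x ∈ Ioo (0:ℝ) (X j) | Y1 x = 0}.Finite →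
      {x ∈ Ioo (0:ℝ) (X j + a) | Y1 x = 0}.Finite ∧
      {x ∈ Ioo (0:ℝ) (X j + a) | Y1 x = 0}.ncard =
        {x ∈ Ioo (0:ℝ) (X j) | Y1 x = 0}.ncard + K.ncard := by
    intro j hj hfin
    have hinj : Function.Injective fun x => X j + a * x := fun x x' hxx => by
      simpa [ha.ne'] using hxx
    have e : {x ∈ Ioo (0:ℝ) (X j + a) | Y1 x = 0} =
        {x ∈ Ioo (0:ℝ) (X j) | Y1 x = 0} ∪ (fun x => X j + a * x) '' K := by
      ext x
      constructor
      · rintro ⟨hx, hx0⟩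
        rcases lt_or_ge x (X j) with hlt | hge
        · exact Or.inl ⟨⟨hx.1, hlt⟩, hx0⟩
        · have hr : (x - X j) / a ∈ Icc (0:ℝ) 1 :=
            ⟨div_nonneg (by linarith) ha.le, by rw [div_le_one ha]; linarith [hx.2]⟩
          have hxe : X j + a * ((x - X j) / a) = x := by field_simp; ring
          have h1 := (hpc j hj _ hr).2.1
          rw [hxe, hx0, mul_zero] at h1
          have h2 := (mul_eq_zero.1 h1.symm).resolve_left (pow_ne_zero _ hc)
          refine Or.inr ⟨(x - X j) / a, ⟨⟨lt_of_le_of_ne hr.1 ?_, ?_⟩, h2⟩, hxe⟩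
          · intro h3
            rw [← h3] at h2
            exact hy10 h2
          · rw [div_lt_one ha]; linarith [hx.2]
      · rintro (⟨hx, hx0⟩ | ⟨r, ⟨hr, hr0⟩, rfl⟩)
        · exact ⟨⟨hx.1, by linarith [hx.2]⟩, hx0⟩
        · have h1 := (hpc j hj r (Ioo_subset_Icc_self hr)).2.1
          rw [hr0, mul_zero] at h1
          refine ⟨⟨?_, ?_⟩, (mul_eq_zero.1 h1).resolve_left ha.ne'⟩
          · have := mul_pos ha hr.1
            have := hXa j
            simp only; linarith
          · have := mul_lt_mul_of_pos_left hr.2 ha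
            simp only; linarith
    have hdisj : Disjoint {x ∈ Ioo (0:ℝ) (X j) | Y1 x = 0} ((fun x => X j + a * x) '' K) := by
      rw [Set.disjoint_left]
      rintro x ⟨hx, -⟩ ⟨r, ⟨hr, -⟩, rfl⟩
      have := mul_pos ha hr.1
      have := hx.2
      simp only at this
      linarith
    rw [e]
    refine ⟨hfin.union (N1.1.image _), ?_⟩
    rw [ncard_union_eq hdisj hfin (N1.1.image _), ncard_image_of_injective _ hinj]
  have hcount : ∀ j : ℕ, j < κ → {x ∈ Ioo (0:ℝ) (X j) | Y1 x = 0}.Finite ∧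
      {x ∈ Ioo (0:ℝ) (X j) | Y1 x = 0}.ncard = j * (K.ncard + 1) := by
    intro j
    induction j with
    | zero =>
      intro _
      have : {x ∈ Ioo (0:ℝ) (X 0) | Y1 x = 0} = ∅ := by simp [X]
      rw [this]
      simp
    | succ j ih =>
      intro hj
      obtain ⟨i1, i2⟩ := ih (by omega)
      obtain ⟨i3, i4⟩ := hpiece_count j (by omega) i1
      have hg := gap j hj (piece_end j (hpc j (by omega)))
      have hne : c ^ (j + 1) * (y1 0 / a) ≠ 0 :=
        mul_ne_zero (pow_ne_zero _ hc) (div_ne_zero hy10 ha.ne')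
      have e : {x ∈ Ioo (0:ℝ) (X (j + 1)) | Y1 x = 0} =
          insert (X j + a + b / 2) {x ∈ Ioo (0:ℝ) (X j + a) | Y1 x = 0} := by
        ext x
        constructor
        · rintro ⟨hx, hx0⟩
          rcases lt_or_ge x (X j + a) with hlt | hge
          · exact Or.inr ⟨⟨hx.1, hlt⟩, hx0⟩
          · have h1 := (hg x ⟨hge, hx.2.le⟩).2.1
            rw [hx0] at h1
            have h2 := (mul_eq_zero.1 h1.symm).resolve_left hne
            left
            field_simp at h2
            linarith
        · rintro (rfl | ⟨hx, hx0⟩)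
          · have hmem : X j + a + b / 2 ∈ Icc (X j + a) (X (j + 1)) :=
              ⟨by linarith, by linarith [hXb j]⟩
            refine ⟨⟨by linarith [hXa j], by linarith [hXb j]⟩, ?_⟩
            rw [(hg _ hmem).2.1]
            field_simp
            ring
          · exact ⟨⟨hx.1, by linarith [hx.2, hXb j]⟩, hx0⟩
      rw [e]
      refine ⟨i3.insert _, ?_⟩
      rw [ncard_insert_of_notMem (fun hmem => by linarith [hmem.1.2]) i3, i4, i2]
      ring
  obtain ⟨i1, i2⟩ := hcount (κ - 1) (by omega)
  have i4 := (hpiece_count (κ - 1) (by omega) i1).2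
  rw [hlast, i2] at i4
  obtain ⟨n, rfl⟩ : ∃ n, κ = n + 1 := ⟨κ - 1, by omega⟩
  rw [← N2.2, i4, ← N1.2]
  simp only [add_tsub_cancel_right]
  ring

end Gluing

section FirstMode

variable {P : ℝ → ℝ} {β l : ℝ} {y y1 y2 z : ℝ → ℝ}

lemma Sol.nonpos_of_monotone (hP : Weight P) (h : Sol P l y y1 y2 z) (z0 : z 0 = 0) (z1 : z 1 = 0)
    (y0 : y 0 ≤ 0) (hmono : ∀ s t, 0 ≤ s → s ≤ t → t ≤ 1 → y s ≤ y t) :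
    ∃ c ∈ Icc (0:ℝ) 1, y c = 0 ∧ ∀ x ∈ Icc (0:ℝ) 1, z x ≤ 0 := by
  have hneg : IsPrimitive P (fun x => -y x) (fun x => -y1 x) (fun x => -z x) := by
    simpa using (h.smul (-1)).dz
  have dneg : ∀ x ∈ Icc (0:ℝ) 1, HasDerivWithinAt (fun x => -y x) (-y1 x) (Icc 0 1) x :=
    fun x hx => (h.d0 x hx).neg
  have y1nonneg : 0 ≤ y 1 := by
    by_contra! hlt
    have := hneg.mul_sub_le hP.mono dneg h.c1.neg (m := -y 1) le_rfl zero_le_one le_rfl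
      fun x hx => neg_le_neg (hmono x 1 hx.1 hx.2 le_rfl)
    rw [hP.one, hP.zero, z0, z1] at this
    linarith
  obtain ⟨c, hc, hyc⟩ := intermediate_value_Icc zero_le_one h.c0 (show (0:ℝ) ∈ Icc (y 0) (y 1) from
    ⟨y0, y1nonneg⟩)
  refine ⟨c, hc, hyc, fun x hx => ?_⟩
  rcases le_total x c with hxc | hxc
  · have := hneg.mul_sub_le hP.mono dneg h.c1.neg (m := 0) le_rfl hx.1 hx.2
      fun t ht => by
        have := hmono t c ht.1 (ht.2.trans hxc) hc.2
        linarith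
    rw [z0] at this
    linarith
  · have := h.dz.mul_sub_le hP.mono h.d0 h.c1 (m := 0) hx.1 hx.2 le_rfl
      fun t ht => by
        have := hmono c t hc.1 (hxc.trans ht.1) ht.2
        linarith
    rw [z1] at this
    linarith

/-- A solution with `y' > 0` that has not reached the right boundary condition only exists for
small parameters. -/
lemma Sol.mul_weight_quarter_le (hP : Weight P) (h : Sol P l y y1 y2 z) (hl : 0 ≤ l)
    (z0 : z 0 = 0) (z1 : z 1 = 0) (b0 : y2 0 = β * y1 0) (b1 : -(β * y1 1) < y2 1)
    (y0 : y 0 ≤ 0) (hpos : ∀ x ∈ Icc (0:ℝ) 1, 0 < y1 x) : l * P (1 / 4) ≤ 64 * β := by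
  have hmono : ∀ s t, 0 ≤ s → s ≤ t → t ≤ 1 → y s ≤ y t := fun s t hs hst ht =>
    le_of_hasDerivWithinAt_nonneg h.d0 hs hst ht
      fun x hx => (hpos x ⟨hs.trans hx.1, hx.2.trans ht⟩).le
  obtain ⟨c, hc, hyc, hz⟩ := h.nonpos_of_monotone hP z0 z1 y0 hmono
  have hanti : ∀ s t, 0 ≤ s → s ≤ t → t ≤ 1 → y2 t ≤ y2 s := fun s t hs hst ht => by
    have := le_of_hasDerivWithinAt_nonneg (fun x hx => (h.d2 x hx).neg) hs hst ht
      fun x hx => by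
        have := mul_nonneg hl (neg_nonneg.2 (hz x ⟨hs.trans hx.1, hx.2.trans ht⟩))
        linarith
    simpa using this
  set s := y1 0 + y1 1 with hs
  have p0 := hpos 0 zero_mem01
  have p1 := hpos 1 one_mem01
  have hslope : ∀ x ∈ Icc (1/4:ℝ) (3/4), s / 4 ≤ y1 x := by
    intro x hx
    have e1 := mul_sub_le_of_le_hasDerivWithinAt h.d1 le_rfl (t := x) (by linarith [hx.1])
      (by linarith [hx.2]) (m := y2 x) fun t ht => hanti t x ht.1 ht.2 (by linarith [hx.2])
    have e2 := mul_sub_le_of_le_hasDerivWithinAt (fun t ht => (h.d1 t ht).neg) (s := x) (t := 1)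
      (m := -y2 x) (by linarith [hx.1]) (by linarith [hx.2]) le_rfl
      fun t ht => neg_le_neg (hanti x t (by linarith [hx.1]) ht.1 ht.2)
    simp only [Pi.neg_apply] at e2
    nlinarith [hx.1, hx.2, mul_le_mul_of_nonneg_left e1 (show 0 ≤ 1 - x by linarith [hx.2]),
      mul_le_mul_of_nonneg_left e2 (show 0 ≤ x by linarith [hx.1])]
  set f : ℝ → ℝ := fun x => l * (y x * (x - c)) with hf
  set f' : ℝ → ℝ := fun x => l * (y1 x * (x - c) + y x) with hf'
  have df : ∀ x ∈ Icc (0:ℝ) 1, HasDerivWithinAt f (f' x) (Icc 0 1) x := fun x hx =>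
    (((h.d0 x hx).mul ((hasDerivWithinAt_id x _).sub_const c)).const_mul l).congr_deriv
      (by simp only [hf', id]; ring)
  have cf' : ContinuousOn f' (Icc 0 1) :=
    continuousOn_const.mul ((h.c1.mul (continuousOn_id.sub continuousOn_const)).add h.c0)
  have hG : IsPrimitive P f f' (fun x => l * (z x * (x - c)) - y2 x) := fun x hx =>
    ((((((h.dz x hx).mul ((hasDerivWithinAt_id x _).sub_const c)).const_mul l).sub
      (h.d2 x hx))).congr_deriv (by simp only [hf', id]; ring)).congr_of_mem
      (fun t _ => by simp only [hf, Pi.sub_apply, Pi.mul_apply, id]; ring) hx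
  have fnonneg : ∀ x ∈ Icc (0:ℝ) 1, 0 ≤ f x := by
    intro x hx
    refine mul_nonneg hl ?_
    rcases le_total x c with hxc | hxc
    · have := hmono x c hx.1 hxc hc.2
      nlinarith
    · have := hmono c x hc.1 hxc hx.2
      exact mul_nonneg (by linarith) (by linarith)
  have hinc : ∀ p q, 0 ≤ p → p ≤ q → q ≤ 1 → (∀ x ∈ Icc p q, l * s / 64 ≤ f x) →
      l * s / 64 * (P q - P p) ≤ y2 0 - y2 1 := by
    intro p q hp hpq hq hm
    have g1 := hG.mul_sub_le hP.mono df cf' le_rfl hp (hpq.trans hq) (m := 0)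
      fun x hx => fnonneg x ⟨hx.1, hx.2.trans (hpq.trans hq)⟩
    have g2 := hG.mul_sub_le hP.mono df cf' hp hpq hq hm
    have g3 := hG.mul_sub_le hP.mono df cf' (hp.trans hpq) hq le_rfl (m := 0)
      fun x hx => fnonneg x ⟨(hp.trans hpq).trans hx.1, hx.2⟩
    simp only [z0, z1] at g1 g3
    linarith
  have hfin : l * s / 64 * P (1 / 4) ≤ y2 0 - y2 1 := by
    rcases le_total (1/2) c with h2 | h2
    · have g := mul_sub_le_of_le_hasDerivWithinAt h.d0 (s := 1/4) (t := 1/2) (m := s / 4)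
        (by norm_num) (by norm_num) (by norm_num)
        fun x hx => hslope x ⟨hx.1, by linarith [hx.2]⟩
      have := hinc 0 (1/4) le_rfl (by norm_num) (by norm_num) fun x hx => by
        have g1 := hmono x (1/4) hx.1 hx.2 (by norm_num)
        have g2 := hmono (1/2) c (by norm_num) h2 hc.2
        have : s / 16 * (1/4) ≤ -y x * (c - x) :=
          mul_le_mul (by linarith) (by linarith [hx.2]) (by norm_num) (by linarith)
        have := mul_le_mul_of_nonneg_left this hl
        simp only [hf]; linarith
      rwa [hP.zero, sub_zero] at this
    · have g := mul_sub_le_of_le_hasDerivWithinAt h.d0 (s := 1/2) (t := 3/4) (m := s / 4)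
        (by norm_num) (by norm_num) (by norm_num)
        fun x hx => hslope x ⟨by linarith [hx.1], hx.2⟩
      have := hinc (3/4) 1 (by norm_num) (by norm_num) le_rfl fun x hx => by
        have g1 := hmono (3/4) x (by norm_num) hx.1 hx.2
        have g2 := hmono c (1/2) hc.1 h2 (by norm_num)
        have : s / 16 * (1/4) ≤ y x * (x - c) :=
          mul_le_mul (by linarith) (by linarith [hx.1]) (by norm_num) (by linarith)
        have := mul_le_mul_of_nonneg_left this hl
        simp only [hf]; linarith
      have e := hP.symm (1/4) (by norm_num)
      rw [show (1:ℝ) - 1/4 = 3/4 by norm_num] at e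
      rwa [hP.one, e, sub_sub_cancel] at this
  by_contra! hcon
  have hs0 : 0 < s := by linarith
  nlinarith [mul_lt_mul_of_pos_right hcon hs0]

lemma Prufer.y1_pos_of_count_eq_zero {y y1 y2 z φ : ℝ → ℝ → ℝ} (hP : Weight P) (hβ : 0 < β)
    (h : Prufer P β y y1 y2 z φ) (hl : 0 ≤ l) (hc : count P β β l = 0) :
    (∀ x ∈ Icc (0:ℝ) 1, 0 < y1 l x) ∧ -(β * y1 l 1) < y2 l 1 := by
  have h1 := (h.count_eq hP hβ hβ hl).2
  rw [hc] at h1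
  have h2 : level φ β l < 0 := by
    rw [← Int.cast_zero, ← Int.floor_lt]; omega
  have h3 : -Real.arctan β < φ l 1 := by
    rw [level, neg_div, neg_lt_zero, div_pos_iff_of_pos_right Real.pi_pos] at h2
    linarith
  have h4 : -(Real.pi / 2) < φ l 1 := by linarith [Real.arctan_lt_pi_div_two β]
  have hupper : ∀ x ∈ Icc (0:ℝ) 1, φ l x < Real.pi / 2 := fun x hx => by
    rcases hx.1.eq_or_lt with rfl | hx0
    · exact (h.phi_zero_mem l).2
    · exact lt_of_level_decreasing (h.deriv l hl) (fun x hx e => h.rot_neg hP hl hx (by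
        rw [e, Real.cos_pi_div_two])) le_rfl hx0 hx.2 (h.phi_zero_mem l).2.le
  have hlower : ∀ x ∈ Icc (0:ℝ) 1, -(Real.pi / 2) < φ l x := fun x hx => by
    by_contra! hle
    rcases hx.2.eq_or_lt with rfl | hx1
    · linarith
    · have := lt_of_level_decreasing (h.deriv l hl) (fun x hx e => h.rot_neg hP hl hx (by
        rw [e, Real.cos_neg, Real.cos_pi_div_two])) hx.1 hx1 le_rfl hle
      linarith
  have hcos : ∀ x ∈ Icc (0:ℝ) 1, 0 < Real.cos (φ l x) := fun x hx =>
    Real.cos_pos_of_mem_Ioo ⟨hlower x hx, hupper x hx⟩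
  refine ⟨fun x hx => ?_, ?_⟩
  · rw [(h.polar hP hl hx).1]
    exact mul_pos (h.sqrt_pos hP hl hx) (hcos x hx)
  · have ht : -β < Real.tan (φ l 1) := by
      have := Real.tan_lt_tan_of_lt_of_lt_pi_div_two
        (by linarith [Real.arctan_lt_pi_div_two β]) (hupper 1 one_mem01) h3
      rwa [Real.tan_neg, Real.tan_arctan] at this
    have hc1 := hcos 1 one_mem01
    rw [Real.tan_eq_sin_div_cos, lt_div_iff₀ hc1] at ht
    have hp := h.polar hP hl one_mem01
    have hr := mul_lt_mul_of_pos_left ht (h.sqrt_pos hP hl one_mem01)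
    rw [← hp.2] at hr
    have e := congrArg (fun t => β * t) hp.1
    linarith

lemma exists_count_pos (hP : Weight P) (hβ : 0 < β) : ∃ l, 0 < l ∧ 1 ≤ count P β β l := by
  have hq : 0 < P (1 / 4) := hP.pos _ (by norm_num)
  refine ⟨65 * β / P (1 / 4), by positivity, ?_⟩
  rw [Nat.one_le_iff_ne_zero]
  intro hc
  obtain ⟨y, y1, y2, z, φ, h⟩ := exists_prufer hP hβ
  have hl : 0 ≤ 65 * β / P (1 / 4) := by positivity
  obtain ⟨h1, h2⟩ := h.y1_pos_of_count_eq_zero hP hβ hl hc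
  have := (h.sh.sol _).mul_weight_quarter_le hP hl (h.sh.z_zero _) (h.sh.z_one _) (h.sh.bc_zero _)
    h2 (h.sh.y_zero_neg _ hl).le h1
  rw [div_mul_cancel₀ _ hq.ne'] at this
  linarith

end FirstMode

section Renormalization

variable {P : ℝ → ℝ} {κ : ℕ} {a b : ℝ}

namespace SelfSim

lemma a_lt_one (hS : SelfSim P κ a b) : a < 1 := by
  have h1 : (2:ℝ) ≤ κ := by exact_mod_cast hS.two_le
  nlinarith [hS.total, hS.a_pos, hS.b_pos]

lemma params (hS : SelfSim P κ a b) : 0 < 2 * a / b ∧ 2 * a / b ≤ 2 / b := by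
  have h1 := hS.a_pos
  have h2 := hS.b_pos
  have h3 := hS.a_lt_one
  exact ⟨by positivity, by gcongr; linarith⟩

lemma scale_eq (hS : SelfSim P κ a b) (l : ℝ) : a ^ 3 * (κ / a ^ 3 * l) = κ * l := by
  have := hS.a_pos
  field_simp

lemma scale_pos (hS : SelfSim P κ a b) : 0 < (κ:ℝ) / a ^ 3 := by
  have h1 := hS.a_pos
  have h2 : (0:ℝ) < κ := by exact_mod_cast (by have := hS.two_le; omega : 0 < κ)
  positivity

/-- Lower bound for the count after rescaling. -/
lemma mul_count_le (hS : SelfSim P κ a b) {l : ℝ} (hl : 0 < l) :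
    κ * count P (2 * a / b) (2 * a / b) l ≤
      count P (2 * a / b) (2 * a / b) (κ / a ^ 3 * l) := by
  obtain ⟨hβ, hββ⟩ := hS.params
  have hs := hS.scale_pos
  rcases Nat.eq_zero_or_pos (count P (2 * a / b) (2 * a / b) l) with h0 | h0
  · simp [h0]
  · obtain ⟨μ, hμ0, hμl, hm, hc⟩ := exists_mode_count_eq hS.weight hβ hβ hl.le h0 le_rfl
    have h1 := (mode_glue hS hμ0 (hS.scale_eq μ) hm).2
    rw [← hc, ← h1]
    refine ((count_diag_bounds hS.weight hβ hββ (by positivity)).1).trans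
      (count_mono hS.weight hβ hβ (by positivity) (by gcongr))

lemma exists_count_ge (hS : SelfSim P κ a b) (n : ℕ) :
    ∃ l, 0 < l ∧ n ≤ count P (2 * a / b) (2 * a / b) l := by
  obtain ⟨l, hl, h1⟩ := exists_count_pos hS.weight hS.params.1
  suffices ∃ l, 0 < l ∧ n + 1 ≤ count P (2 * a / b) (2 * a / b) l by
    obtain ⟨l, h1, h2⟩ := this
    exact ⟨l, h1, by omega⟩
  induction n with
  | zero => exact ⟨l, hl, h1⟩
  | succ n ih =>
    obtain ⟨l, hl, h1⟩ := ih
    refine ⟨κ / a ^ 3 * l, mul_pos hS.scale_pos hl, le_trans ?_ (hS.mul_count_le hl)⟩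
    have := hS.two_le
    nlinarith

/-- Upper bound for the count after rescaling. -/
lemma count_le_mul (hS : SelfSim P κ a b) {l : ℝ} (hl : 0 < l) :
    count P (2 * a / b) (2 * a / b) (κ / a ^ 3 * l) ≤
      κ * count P (2 * a / b) (2 * a / b) l + κ + 1 := by
  obtain ⟨hβ, hββ⟩ := hS.params
  have hβ' := hβ.trans_le hββ
  have hs := hS.scale_pos
  set n := count P (2 * a / b) (2 * a / b) l with hn
  obtain ⟨L, hL, hcL⟩ := hS.exists_count_ge (n + 1)
  obtain ⟨μ, hμ0, -, hm, hc⟩ := exists_mode_count_eq hS.weight hβ hβ hL.le (by omega) hcL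
  have hlt : l < μ := by
    by_contra! hle
    have := count_mono hS.weight hβ hβ hμ0.le hle
    omega
  obtain ⟨h1, h2⟩ := mode_glue hS hμ0 (hS.scale_eq μ) hm
  have h3 := count_lt hS.weight hβ' hβ' (l := κ / a ^ 3 * l) (by positivity) (by gcongr) h1
  have h4 := (count_diag_bounds hS.weight hβ hββ (l := κ / a ^ 3 * l) (by positivity)).2
  rw [h2, hc, mul_add, mul_one] at h3
  omega

end SelfSim

end Renormalization

section CantorWeight

variable {P : ℝ → ℝ} {κ : ℕ} {a b : ℝ}

lemma exists_piece_or_gap (ha : 0 < a) (hb : 0 < b)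
    (htot : κ * a + (κ - 1) * b = 1) {x : ℝ} (hx : x ∈ Icc (0:ℝ) 1) :
    ∃ k : ℕ, (k < κ ∧ ∃ t ∈ Icc (0:ℝ) 1, x = k * (a + b) + a * t) ∨
      (k + 1 < κ ∧ x ∈ Icc (k * (a + b) + a) ((k + 1) * (a + b))) := by
  have hd : 0 < a + b := by positivity
  set k := ⌊x / (a + b)⌋₊ with hk
  have h1 : k * (a + b) ≤ x := by
    rw [← le_div_iff₀ hd]
    exact Nat.floor_le (div_nonneg hx.1 hd.le)
  have h2 : x < (k + 1) * (a + b) := by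
    rw [← div_lt_iff₀ hd]
    exact Nat.lt_floor_add_one _
  have hkκ : k < κ := by
    have : (k:ℝ) * (a + b) < κ * (a + b) := by nlinarith [hx.2]
    exact_mod_cast lt_of_mul_lt_mul_right this hd.le
  refine ⟨k, ?_⟩
  rcases le_or_gt x (k * (a + b) + a) with h3 | h3
  · refine Or.inl ⟨hkκ, (x - k * (a + b)) / a, ⟨div_nonneg (by linarith) ha.le, ?_⟩, ?_⟩
    · rw [div_le_one ha]; linarith
    · field_simp
      ring
  · refine Or.inr ⟨?_, h3.le, h2.le⟩
    have hx1 := hx.2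
    have : ((k + 1 : ℕ) : ℝ) * (a + b) < κ * (a + b) := by
      push_cast
      nlinarith
    exact_mod_cast lt_of_mul_lt_mul_right this hd.le

lemma symm_of_pieces (ha : 0 < a) (hb : 0 < b) (hκ : 2 ≤ κ) (htot : κ * a + (κ - 1) * b = 1)
    (hc : ContinuousOn P (Icc 0 1))
    (hpiece : ∀ k : ℕ, k < κ → ∀ x ∈ Icc (0:ℝ) 1, P (k * (a + b) + a * x) = (P x + k) / κ)
    (hgap : ∀ k : ℕ, k + 1 < κ → ∀ x ∈ Icc (k * (a + b) + a) ((k + 1) * (a + b)),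
      P x = (k + 1) / κ) :
    ∀ x ∈ Icc (0:ℝ) 1, P (1 - x) = 1 - P x := by
  have hκ2 : (2:ℝ) ≤ κ := by exact_mod_cast hκ
  have hκ0 : (0:ℝ) < κ := by linarith
  set g : ℝ → ℝ := fun x => |P x + P (1 - x) - 1| with hg
  have gc : ContinuousOn g (Icc 0 1) :=
    ((hc.add (hc.comp (continuousOn_const.sub continuousOn_id) fun x hx => one_sub_mem hx)).sub
      continuousOn_const).abs
  obtain ⟨m, hm, hmax⟩ := isCompact_Icc.exists_isMaxOn ⟨(0:ℝ), zero_mem01⟩ gc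
  have hbound : g m ≤ g m / κ := by
    obtain ⟨k, ⟨hk, t, ht, e⟩ | ⟨hk, h1, h2⟩⟩ := exists_piece_or_gap ha hb htot hm
    · have e' : 1 - m = ((κ - 1 - k : ℕ) : ℝ) * (a + b) + a * (1 - t) := by
        rw [Nat.cast_sub (by omega), Nat.cast_sub (by omega)]
        push_cast
        linarith
      have : g m = g t / κ := by
        simp only [hg]
        rw [e', hpiece _ (by omega) _ (one_sub_mem ht), e, hpiece k hk t ht,
          ← abs_of_pos hκ0, ← abs_div, abs_of_pos hκ0,
          Nat.cast_sub (by omega), Nat.cast_sub (by omega)]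
        congr 1
        push_cast
        field_simp
        ring
      rw [this]
      gcongr
      rw [← this]
      exact hmax ht
    · have : g m = 0 := by
        simp only [hg]
        have e1 : ((κ - 2 - k : ℕ) : ℝ) = κ - 2 - k := by
          rw [Nat.cast_sub (by omega), Nat.cast_sub (by omega)]
          push_cast
          rfl
        rw [hgap k hk m ⟨h1, h2⟩, hgap (κ - 2 - k) (by omega) (1 - m) (by
          rw [e1]; constructor <;> linarith), e1, abs_eq_zero]
        field_simp
        ring
      rw [this, zero_div]
  have h0 : 0 ≤ g m := abs_nonneg _
  have hm0 : g m = 0 := by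
    rw [le_div_iff₀ hκ0] at hbound
    nlinarith
  intro x hx
  have h1 : g x ≤ 0 := hm0 ▸ hmax hx
  have := abs_eq_zero.1 (le_antisymm h1 (abs_nonneg _))
  linarith

lemma pos_of_pieces (ha : 0 < a) (ha1 : a < 1) (hκ : 2 ≤ κ) (hmono : MonotoneOn P (Icc 0 1))
    (h1 : P 1 = 1) (hpiece : ∀ x ∈ Icc (0:ℝ) 1, P (a * x) = P x / κ) :
    ∀ x ∈ Ioc (0:ℝ) 1, 0 < P x := by
  have hκ0 : (0:ℝ) < κ := by exact_mod_cast (by omega : 0 < κ)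
  have hpow : ∀ n : ℕ, a ^ n ∈ Icc (0:ℝ) 1 := fun n =>
    ⟨by positivity, pow_le_one₀ ha.le ha1.le⟩
  have hpos : ∀ n : ℕ, 0 < P (a ^ n) := by
    intro n
    induction n with
    | zero => simp [h1]
    | succ n ih =>
      rw [pow_succ', hpiece _ (hpow n)]
      positivity
  intro x hx
  obtain ⟨n, hn⟩ := exists_pow_lt_of_lt_one hx.1 ha1
  exact (hpos n).trans_le (hmono (hpow n) (Ioc_subset_Icc_self hx) hn.le)

lemma selfSim_of_cantorSelfSimilar (h : CantorSelfSimilar P κ a) : SelfSim P κ a (bb κ a) := by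
  obtain ⟨hc, hmono, h0, h1, hκ, ha, haκ, hpc, hgc⟩ := h
  have hκ2 : (2:ℝ) ≤ κ := by exact_mod_cast hκ
  have hκ0 : (0:ℝ) < κ := by linarith
  have haκ' : κ * a < 1 := by rwa [lt_div_iff₀' hκ0] at haκ
  have hb : 0 < bb κ a := div_pos (by linarith) (by linarith)
  have htot : κ * a + (κ - 1) * bb κ a = 1 := by
    have : (κ:ℝ) - 1 ≠ 0 := by linarith
    rw [bb]
    field_simp
    ring
  set b := bb κ a with hbdef
  have hgap' : ∀ k : ℕ, k + 1 < κ → ∀ x ∈ Icc (k * (a + b) + a) ((k + 1) * (a + b)),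
      P x = P ((k + 1) * (a + b)) := by
    intro k hk
    have hk' : (k:ℝ) + 2 ≤ κ := by exact_mod_cast (by omega : k + 2 ≤ κ)
    have hlt : k * (a + b) + a < (k + 1) * (a + b) := by linarith
    set p := (k * (a + b) + a + (k + 1) * (a + b)) / 2 with hp
    have hpm : p ∈ Ioo (k * (a + b) + a) ((k + 1) * (a + b)) :=
      ⟨by rw [hp]; linarith, by rw [hp]; linarith⟩
    have hsub : Icc (k * (a + b) + a) ((k + 1) * (a + b)) ⊆ Icc 0 1 :=
      Icc_subset_Icc (by positivity) (by nlinarith)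
    have heq : EqOn P (fun _ => P p) (Ioo (k * (a + b) + a) ((k + 1) * (a + b))) := by
      have e : ((k + 1 : ℕ) : ℝ) * (a + b) - b = k * (a + b) + a := by push_cast; ring
      have := hgc (k + 1) (by omega) hk
      rw [e] at this
      push_cast at this
      exact fun x hx => this x hx p hpm
    have hcl := heq.of_subset_closure (hc.mono hsub) continuousOn_const Ioo_subset_Icc_self
      (closure_Ioo hlt.ne).ge
    intro x hx
    rw [hcl hx, hcl (right_mem_Icc.2 hlt.le)]
  have hpiece' : ∀ k : ℕ, k < κ → ∀ x ∈ Icc (0:ℝ) 1,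
      κ * P (k * (a + b) + a * x) = P x + κ * P (k * (a + b)) := by
    intro k hk x hx
    obtain ⟨c, hc⟩ := hpc k hk
    have e0 := hc 0 zero_mem01
    rw [mul_zero, add_zero, h0, zero_add] at e0
    rw [hc x hx, e0]
  have hval : ∀ k : ℕ, k < κ → κ * P (k * (a + b)) = k := by
    intro k
    induction k with
    | zero => simp [h0]
    | succ k ih =>
      intro hk
      have e1 := hpiece' k (by omega) 1 one_mem01
      rw [mul_one, h1, ih (by omega), hgap' k hk _ (left_mem_Icc.2 (by linarith))] at e1
      push_cast
      rw [e1, add_comm]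
  have hpiece : ∀ k : ℕ, k < κ → ∀ x ∈ Icc (0:ℝ) 1,
      P (k * (a + b) + a * x) = (P x + k) / κ := fun k hk x hx => by
    rw [eq_div_iff hκ0.ne', mul_comm, hpiece' k hk x hx, hval k hk]
  have hgap : ∀ k : ℕ, k + 1 < κ → ∀ x ∈ Icc (k * (a + b) + a) ((k + 1) * (a + b)),
      P x = (k + 1) / κ := fun k hk x hx => by
    have := hval (k + 1) hk
    push_cast at this
    rw [hgap' k hk x hx, eq_div_iff hκ0.ne', mul_comm, this]
  exact ⟨⟨hc, hmono, h0, h1, symm_of_pieces ha hb hκ htot hc hpiece hgap,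
    pos_of_pieces ha (by nlinarith) hκ hmono h1 fun x hx => by
      simpa using hpiece 0 (by omega) x hx⟩, hκ, ha, hb, htot, hpiece, hgap⟩

end CantorWeight

section Eigenvalues

variable {P : ℝ → ℝ} {β l : ℝ} {y y1 y2 y3 z : ℝ → ℝ}

lemma contDiffOn_succ_of_hasDerivWithinAt {n : ℕ} {f f' : ℝ → ℝ}
    (h : ∀ x ∈ Icc (0:ℝ) 1, HasDerivWithinAt f (f' x) (Icc 0 1) x)
    (hf' : ContDiffOn ℝ n f' (Icc 0 1)) : ContDiffOn ℝ (n + 1 : ℕ) f (Icc 0 1) := by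
  have hu := uniqueDiffOn_Icc (zero_lt_one' ℝ)
  push_cast
  rw [contDiffOn_succ_iff_derivWithin hu]
  exact ⟨fun x hx => (h x hx).differentiableWithinAt, by simp,
    hf'.congr fun x hx => (h x hx).derivWithin (hu x hx)⟩

/-- A chain of derivatives computes the iterated derivatives on `[0,1]`. -/
lemma derivs_of_chain (d0 : ∀ x ∈ Icc (0:ℝ) 1, HasDerivWithinAt y (y1 x) (Icc 0 1) x)
    (d1 : ∀ x ∈ Icc (0:ℝ) 1, HasDerivWithinAt y1 (y2 x) (Icc 0 1) x)
    (d2 : ∀ x ∈ Icc (0:ℝ) 1, HasDerivWithinAt y2 (y3 x) (Icc 0 1) x)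
    (c3 : ContinuousOn y3 (Icc 0 1)) :
    ContDiffOn ℝ 3 y (Icc 0 1) ∧
      ∀ x ∈ Icc (0:ℝ) 1, Y1 y x = y1 x ∧ Y2 y x = y2 x ∧ Y3 y x = y3 x := by
  have hu := uniqueDiffOn_Icc (zero_lt_one' ℝ)
  have e1 : ∀ x ∈ Icc (0:ℝ) 1, Y1 y x = y1 x := fun x hx => (d0 x hx).derivWithin (hu x hx)
  have e2 : ∀ x ∈ Icc (0:ℝ) 1, Y2 y x = y2 x := fun x hx => by
    rw [Y2, iteratedDerivWithin_succ, derivWithin_congr (f := y1) _ _]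
    · exact (d1 x hx).derivWithin (hu x hx)
    · intro t ht
      rw [iteratedDerivWithin_one]
      exact e1 t ht
    · rw [iteratedDerivWithin_one]
      exact e1 x hx
  have e3 : ∀ x ∈ Icc (0:ℝ) 1, Y3 y x = y3 x := fun x hx => by
    rw [Y3, iteratedDerivWithin_succ, ← Y2]
    exact (derivWithin_congr e2 (e2 x hx)).trans ((d2 x hx).derivWithin (hu x hx))
  have h0 : ContDiffOn ℝ (0:ℕ) y3 (Icc 0 1) := by simpa [contDiffOn_zero] using c3
  exact ⟨contDiffOn_succ_of_hasDerivWithinAt d0 (contDiffOn_succ_of_hasDerivWithinAt d1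
    (contDiffOn_succ_of_hasDerivWithinAt d2 h0)), fun x hx => ⟨e1 x hx, e2 x hx, e3 x hx⟩⟩

lemma Sol.of_solutionOn (hl : l ≠ 0) (h : SolutionOn P l y) :
    Sol P l y (Y1 y) (Y2 y) (fun x => Y3 y x / l) := by
  obtain ⟨hy, hd⟩ := h
  have hu := uniqueDiffOn_Icc (zero_lt_one' ℝ)
  refine ⟨fun x hx => ?_, fun x hx => ?_, fun x hx => ?_, fun x hx => ?_⟩
  · exact (hy.differentiableOn (by norm_num) x hx).hasDerivWithinAt
  · have := (hy.differentiableOn_iteratedDerivWithin (m := 1) (by norm_num) hu x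
      hx).hasDerivWithinAt
    rwa [← iteratedDerivWithin_succ, iteratedDerivWithin_one] at this
  · have := (hy.differentiableOn_iteratedDerivWithin (m := 2) (by norm_num) hu x
      hx).hasDerivWithinAt
    rw [← iteratedDerivWithin_succ] at this
    rwa [mul_div_cancel₀ _ hl]
  · exact (((hd x hx).div_const l).congr_deriv (by field_simp)).congr_of_mem
      (fun t _ => by field_simp) hx

lemma isEigenvalue_iff_mode (hP : Weight P) (hβ : 0 < β) (hl : l ≠ 0) :
    IsEigenvalue P 0 β l ↔ Mode P β β l := by
  constructor
  · rintro ⟨y, hnt, hs, b1, b2, b3, b4⟩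
    have hβ' := hβ.ne'
    have z0 : Y3 y 0 = 0 := by simpa [hβ'] using b2
    have z1 : Y3 y 1 = 0 := by simpa [hβ'] using b4
    exact ⟨y, _, _, _, Sol.of_solutionOn hl hs, by simp [z0], by simp [z1], by linarith,
      by linarith, hnt⟩
  · rintro ⟨y, y1, y2, z, h, z0, z1, b0, b1, hnt⟩
    obtain ⟨hy, hd⟩ := derivs_of_chain h.d0 h.d1 h.d2 (continuousOn_const.mul (h.cz hP))
    obtain ⟨e1, e2, e3⟩ := hd 0 zero_mem01
    obtain ⟨f1, f2, f3⟩ := hd 1 one_mem01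
    refine ⟨y, hnt, ⟨hy, fun x hx => ?_⟩, ?_, ?_, ?_, ?_⟩
    · exact (((h.dz x hx).const_mul l).congr_deriv (by rw [(hd x hx).1]; ring)).congr_of_mem
        (fun t ht => by rw [(hd t ht).2.2]; ring) hx
    · rw [e1, e2, b0]; ring
    · rw [e2, e3, z0]; ring
    · rw [f1, f2, b1]; ring
    · rw [f2, f3, z1]; ring

lemma isEigenvalue_zero : IsEigenvalue P 0 β 0 := by
  obtain ⟨hy, hd⟩ := derivs_of_chain (y := fun _ => 1) (y1 := fun _ => 0) (y2 := fun _ => 0)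
    (y3 := fun _ => 0) (fun x _ => hasDerivWithinAt_const x _ _)
    (fun x _ => hasDerivWithinAt_const x _ _) (fun x _ => hasDerivWithinAt_const x _ _)
    continuousOn_const
  obtain ⟨e1, e2, e3⟩ := hd 0 zero_mem01
  obtain ⟨f1, f2, f3⟩ := hd 1 one_mem01
  refine ⟨fun _ => 1, ⟨0, zero_mem01, one_ne_zero⟩, ⟨hy, fun x hx => ?_⟩, ?_, ?_, ?_, ?_⟩
  · exact ((hasDerivWithinAt_const x (Icc (0:ℝ) 1) (0:ℝ)).congr_deriv (by ring)).congr_of_mem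
      (fun t ht => by rw [(hd t ht).2.2]; ring) hx
  · rw [e1, e2]; ring
  · rw [e2, e3]; ring
  · rw [f1, f2]; ring
  · rw [f2, f3]; ring

lemma not_mode_of_neg (hP : Weight P) (hβ : 0 < β) (hl : l < 0) : ¬ Mode P β β l := by
  rintro ⟨y, y1, y2, z, h, z0, z1, b0, b1, x₀, hx₀, hne⟩
  set v : ℝ → ℝ := IccExtend (zero_le_one' ℝ) ((Icc (0:ℝ) 1).domRestrict fun x => y2 x ^ 2) with hv
  have vc : Continuous v := ((h.c2.pow 2).domRestrict).Icc_extend'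
  have hve : ∀ x ∈ Icc (0:ℝ) 1, v x = y2 x ^ 2 := fun x hx => by
    rw [hv, IccExtend_of_mem _ _ hx]; rfl
  set V : ℝ → ℝ := fun x => ∫ t in (0:ℝ)..x, v t with hV
  have dV : ∀ x ∈ Icc (0:ℝ) 1, HasDerivWithinAt V (y2 x ^ 2) (Icc 0 1) x := fun x hx => by
    rw [← hve x hx]
    exact (vc.integral_hasStrictDerivAt 0 x).hasDerivAt.hasDerivWithinAt
  have hl0 := hl.ne
  set G : ℝ → ℝ := fun x => z x * y x - (y2 x * y1 x - V x) / l with hG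
  have dsq : ∀ x ∈ Icc (0:ℝ) 1,
      HasDerivWithinAt (fun x => y x ^ 2) (2 * y x * y1 x) (Icc 0 1) x := fun x hx =>
    ((h.d0 x hx).pow 2).congr_deriv (by norm_num)
  have csq : ContinuousOn (fun x => 2 * y x * y1 x) (Icc 0 1) :=
    (continuousOn_const.mul h.c0).mul h.c1
  have hGP : IsPrimitive P (fun x => y x ^ 2) (fun x => 2 * y x * y1 x) G := fun x hx => by
    refine ((((h.dz x hx).mul (h.d0 x hx)).sub
      ((((h.d2 x hx).mul (h.d1 x hx)).sub (dV x hx)).div_const l)).congr_deriv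
      ?_).congr_of_mem (fun t _ => ?_) hx
    · field_simp
      ring
    · simp only [hG, Pi.sub_apply, Pi.mul_apply]
      ring
  have hV01 : V 0 ≤ V 1 :=
    le_of_hasDerivWithinAt_nonneg dV le_rfl zero_le_one le_rfl fun x _ => sq_nonneg _
  have hG01 : l * (G 1 - G 0) = β * (y1 1 ^ 2 + y1 0 ^ 2) + (V 1 - V 0) := by
    simp only [hG, z0, z1, b0, b1]
    field_simp
    ring
  have hGnn := hGP.mul_sub_le hP.mono dsq csq le_rfl zero_le_one le_rfl (m := 0)
    fun x _ => sq_nonneg _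
  rw [zero_mul] at hGnn
  have hlG : l * (G 1 - G 0) ≤ 0 := mul_nonpos_of_nonpos_of_nonneg hl.le hGnn
  have q1 : 0 ≤ β * y1 1 ^ 2 := by positivity
  have q0 : 0 ≤ β * y1 0 ^ 2 := by positivity
  have y10 : y1 0 = 0 := by
    have : β * y1 0 ^ 2 = 0 := by linarith
    simpa [hβ.ne'] using this
  have hGe : G 1 - G 0 = 0 := by
    have : l * (G 1 - G 0) = 0 := by linarith
    simpa [hl0] using this
  have hVe : ∀ x ∈ Icc (0:ℝ) 1, V x = V 0 := fun x hx => by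
    have g1 := le_of_hasDerivWithinAt_nonneg dV le_rfl hx.1 hx.2 fun x _ => sq_nonneg _
    have g2 := le_of_hasDerivWithinAt_nonneg dV hx.1 hx.2 le_rfl fun x _ => sq_nonneg _
    linarith
  have hy2 : ∀ x ∈ Icc (0:ℝ) 1, y2 x = 0 := fun x hx => by
    have g1 : HasDerivWithinAt V 0 (Icc 0 1) x :=
      (hasDerivWithinAt_const x _ (V 0)).congr_of_mem hVe hx
    simpa using (uniqueDiffOn_Icc (zero_lt_one' ℝ) x hx).eq_deriv _ (dV x hx) g1
  have hy1 : ∀ x ∈ Icc (0:ℝ) 1, y1 x = 0 := fun x hx => by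
    rw [eq_of_hasDerivWithinAt_zero h.d1 le_rfl hx.1 hx.2
      fun t ht => hy2 t ⟨ht.1, ht.2.trans hx.2⟩, y10]
  have hy : ∀ x ∈ Icc (0:ℝ) 1, y x = y 0 := fun x hx =>
    eq_of_hasDerivWithinAt_zero h.d0 le_rfl hx.1 hx.2 fun t ht => hy1 t ⟨ht.1, ht.2.trans hx.2⟩
  have := hGP.mul_sub_le hP.mono dsq csq le_rfl zero_le_one le_rfl (m := y 0 ^ 2)
    fun x hx => by rw [hy x hx]
  rw [hP.one, hP.zero, hGe, sub_zero, mul_one] at this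
  rw [hy x₀ hx₀] at hne
  exact absurd this (by have := sq_pos_of_ne_zero hne; linarith)

lemma ncard_isEigenvalue (hP : Weight P) (hβ : 0 < β) (hl : 0 < l) :
    {μ : ℝ | IsEigenvalue P 0 β μ ∧ μ ≤ l}.ncard = count P β β l + 1 := by
  have e : {μ : ℝ | IsEigenvalue P 0 β μ ∧ μ ≤ l} =
      insert 0 {μ | 0 < μ ∧ μ ≤ l ∧ Mode P β β μ} := by
    ext μ
    simp only [mem_insert_iff, mem_ofPred_eq]
    constructor
    · rintro ⟨h1, h2⟩
      rcases lt_trichotomy μ 0 with h3 | h3 | h3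
      · exact absurd ((isEigenvalue_iff_mode hP hβ h3.ne).1 h1) (not_mode_of_neg hP hβ h3)
      · exact Or.inl h3
      · exact Or.inr ⟨h3, h2, (isEigenvalue_iff_mode hP hβ h3.ne').1 h1⟩
    · rintro (rfl | ⟨h1, h2, h3⟩)
      · exact ⟨isEigenvalue_zero, hl.le⟩
      · exact ⟨(isEigenvalue_iff_mode hP hβ h1.ne').2 h3, h2⟩
  rw [e, ncard_insert_of_notMem (fun h => h.1.false) (finite_modes hP hβ hβ hl.le)]
  rfl

end Eigenvalues

lemma tendstoUniformlyOn_of_geometric {s : Set ℝ} {f : ℕ → ℝ → ℝ} {r : ℝ} (hr0 : 0 ≤ r)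
    (hr1 : r < 1) (h : ∀ k, ∀ t ∈ s, |f (k + 1) t - f k t| ≤ r ^ k) :
    ∃ g : ℝ → ℝ, TendstoUniformlyOn f g atTop s := by
  have hd : ∀ t ∈ s, ∀ k, dist (f k t) (f (k + 1) t) ≤ 1 * r ^ k := fun t ht k => by
    rw [one_mul, dist_comm, Real.dist_eq]
    exact h k t ht
  have hlim : ∀ t ∈ s, ∃ c, Tendsto (fun k => f k t) atTop (nhds c) := fun t ht =>
    cauchySeq_tendsto_of_complete (cauchySeq_of_le_geometric r 1 hr1 (hd t ht))
  choose! g hg using hlim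
  refine ⟨g, Metric.tendstoUniformlyOn_iff.2 fun ε hε => ?_⟩
  have h0 : Tendsto (fun n : ℕ => 1 * r ^ n / (1 - r)) atTop (nhds 0) := by
    simpa using (tendsto_pow_atTop_nhds_zero_of_lt_one hr0 hr1).div_const (1 - r)
  filter_upwards [h0.eventually_lt_const hε] with n hn t ht
  rw [dist_comm]
  exact (dist_le_of_le_geometric_of_tendsto r 1 hr1 (hd t ht) (hg t ht) n).trans_lt hn

lemma exp_log_sub_mul {κ : ℕ} {a : ℝ} (hκ : 0 < κ) (ha : 0 < a) (t : ℝ) :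
    Real.exp (Real.log κ - 3 * Real.log a + t) = κ / a ^ 3 * Real.exp t := by
  rw [Real.exp_add, Real.exp_sub, Real.exp_log (by positivity), mul_comm 3, Real.exp_mul,
    Real.exp_log ha]
  norm_cast

end CantorBeam

theorem stmt16 (P : ℝ → ℝ) (κ : ℕ) (a : ℝ) (hP : CantorSelfSimilar P κ a)
    (N : ℝ → ℕ)
    (hN : ∀ lam : ℝ, 0 < lam →
      N lam = {μ : ℝ | IsEigenvalue P 0 (2 * a / bb κ a) μ ∧ μ ≤ lam}.ncard)
    (ν : ℝ) (hν : ν = Real.log κ - 3 * Real.log a)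
    (σk : ℕ → ℝ → ℝ)
    (hσk : ∀ (k : ℕ) (t : ℝ), σk k t = ((κ:ℝ)⁻¹) ^ k * N (Real.exp (k * ν + t))) :
    (∀ k : ℕ, ∀ t ∈ Set.Icc (0:ℝ) ν, |σk (k + 1) t - σk k t| ≤ ((κ:ℝ)⁻¹) ^ k) ∧
    ∃ σ : ℝ → ℝ, TendstoUniformlyOn σk σ Filter.atTop (Set.Icc 0 ν) := by

  have hS := CantorBeam.selfSim_of_cantorSelfSimilar hP
  have hκ : (2:ℝ) ≤ κ := by exact_mod_cast hS.two_le
  have hκ0 : (0:ℝ) < κ := by linarith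
  have hβ := hS.params.1
  have hstep : ∀ k : ℕ, ∀ t ∈ Set.Icc (0:ℝ) ν, |σk (k + 1) t - σk k t| ≤ ((κ:ℝ)⁻¹) ^ k := by
    intro k t _
    have hl := Real.exp_pos (k * ν + t)
    have e : Real.exp ((k + 1 : ℕ) * ν + t) = κ / a ^ 3 * Real.exp (k * ν + t) := by
      rw [← CantorBeam.exp_log_sub_mul (by have := hS.two_le; omega) hS.a_pos, hν]
      congr 1
      push_cast
      ring
    have hl' := mul_pos hS.scale_pos hl
    have h1 := hS.mul_count_le hl
    have h2 := hS.count_le_mul hl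
    have n1 := (hN _ hl).trans (CantorBeam.ncard_isEigenvalue hS.weight hβ hl)
    have n2 := (hN _ hl').trans (CantorBeam.ncard_isEigenvalue hS.weight hβ hl')
    rw [hσk, hσk, e, n1, n2]
    set n := CantorBeam.count P (2 * a / bb κ a) (2 * a / bb κ a) (Real.exp (k * ν + t))
    set m := CantorBeam.count P (2 * a / bb κ a) (2 * a / bb κ a)
      (κ / a ^ 3 * Real.exp (k * ν + t))
    have h1' : (κ:ℝ) * n ≤ m := by exact_mod_cast h1
    have h2' : (m:ℝ) ≤ κ * n + κ + 1 := by exact_mod_cast h2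
    have e2 : ((κ:ℝ)⁻¹) ^ (k + 1) * ((m + 1 : ℕ) : ℝ) - ((κ:ℝ)⁻¹) ^ k * ((n + 1 : ℕ) : ℝ) =
        ((κ:ℝ)⁻¹) ^ k * ((m + 1 - κ * (n + 1)) / κ) := by
      rw [pow_succ]
      push_cast
      field_simp
    rw [e2, abs_mul, abs_of_pos (by positivity)]
    refine mul_le_of_le_one_right (by positivity) ?_
    rw [abs_div, abs_of_pos hκ0, div_le_one hκ0, abs_le]
    constructor <;> linarith
  exact ⟨hstep, CantorBeam.tendstoUniformlyOn_of_geometric (by positivity)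
    (inv_lt_one_of_one_lt₀ (by linarith)) hstep⟩
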